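/- There exist constants C > 0 and α₀ ∈ (0,1] such that for every statistics parameter α ∈ (0, α₀], liminf_{N→∞} E^N_N(α)/N² ≥ (π/4) α (1 − C α^{1/3}). -/

import Mathlib

noncomputable section

open MeasureTheory Real Set
open scoped BigOperators Topology

/-- The plane `ℝ²`, with points written as pairs. -/
abbrev Plane : Type := ℝ × ℝ

/-- Configuration space of `N` particles in the plane. -/
abbrev Config (N : ℕ) : Type := Fin N → Plane

/-- `x^{-⊥} := (-y, x)/(x² + y²)` for `x = (x, y) ∈ ℝ²`. -/
def perpInv (v : Plane) : Plane :=
  (-v.2 / (v.1 ^ 2 + v.2 ^ 2), v.1 / (v.1 ^ 2 + v.2 ^ 2))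

/-- The Aharonov–Bohm potential `A_j(x) = ∑_{k ≠ j} (x_j - x_k)^{-⊥}`. -/
def abPot (N : ℕ) (j : Fin N) (x : Config N) : Plane :=
  ∑ k ∈ Finset.univ.erase j, perpInv (x j - x k)

/-- Partial derivative of `Ψ` at `x` in direction `v` of the `j`-th particle. -/
def pder (N : ℕ) (j : Fin N) (v : Plane) (Ψ : Config N → ℂ) (x : Config N) : ℂ :=
  fderiv ℝ Ψ x (Pi.single j v)

/-- The two components of `D_j Ψ = -i ∇_{x_j} Ψ + α A_j Ψ` at `x`. -/
def DOp (N : ℕ) (α : ℝ) (j : Fin N) (Ψ : Config N → ℂ) (x : Config N) : ℂ × ℂ :=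
  (-Complex.I * pder N j (1, 0) Ψ x + Complex.ofReal (α * (abPot N j x).1) * Ψ x,
   -Complex.I * pder N j (0, 1) Ψ x + Complex.ofReal (α * (abPot N j x).2) * Ψ x)

/-- `|D_j Ψ(x)|²`, the squared Euclidean norm of the vector `D_j Ψ(x) ∈ ℂ²`. -/
def DSq (N : ℕ) (α : ℝ) (j : Fin N) (Ψ : Config N → ℂ) (x : Config N) : ℝ :=
  ‖(DOp N α j Ψ x).1‖ ^ 2 + ‖(DOp N α j Ψ x).2‖ ^ 2

/-- The diagonal set `{x : x_j = x_k for some j ≠ k}`. -/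
def diagSet (N : ℕ) : Set (Config N) := {x | ∃ j k : Fin N, j ≠ k ∧ x j = x k}

/-- Admissible wave functions: smooth, symmetric, vanishing on a neighbourhood of
the diagonal set. -/
structure Admissible (N : ℕ) (Ψ : Config N → ℂ) : Prop where
  smooth : ContDiff ℝ (⊤ : ℕ∞) Ψ
  symm : ∀ (σ : Equiv.Perm (Fin N)) (x : Config N), Ψ (x ∘ σ) = Ψ x
  vanishes : ∃ U : Set (Config N), IsOpen U ∧ diagSet N ⊆ U ∧ ∀ x ∈ U, Ψ x = 0

/-- `Ω^N` as a subset of configuration space. -/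
def cube (N : ℕ) (Ω : Set Plane) : Set (Config N) := Set.univ.pi fun _ => Ω

/-- Total kinetic energy `∑_j ∫_{Ω^N} |D_j Ψ|²`. -/
def kinE (N : ℕ) (α : ℝ) (Ω : Set Plane) (Ψ : Config N → ℂ) : ℝ :=
  ∑ j, ∫ x in cube N Ω, DSq N α j Ψ x

/-- `∫_{Ω^N} |Ψ|²`. -/
def normSq (N : ℕ) (Ω : Set Plane) (Ψ : Config N → ℂ) : ℝ :=
  ∫ x in cube N Ω, ‖Ψ x‖ ^ 2

/-- Neumann ground-state energy of `N` anyons with statistics parameter `α` on `Ω`,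
with the convention that it is `0` for `N = 0`. -/
def neumannE (N : ℕ) (α : ℝ) (Ω : Set Plane) : ℝ :=
  if N = 0 then 0 else
    sInf {E | ∃ Ψ : Config N → ℂ, Admissible N Ψ ∧ normSq N Ω Ψ = 1 ∧ E = kinE N α Ω Ψ}

/-- Dirichlet ground-state energy of `N` anyons with statistics parameter `α` on `Ω`. -/
def dirichletE (N : ℕ) (α : ℝ) (Ω : Set Plane) : ℝ :=
  sInf {E | ∃ Ψ : Config N → ℂ, Admissible N Ψ ∧ IsCompact (tsupport Ψ) ∧
    tsupport Ψ ⊆ cube N Ω ∧ normSq N Ω Ψ = 1 ∧ E = kinE N α Ω Ψ}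

/-- The open unit square `Q₀ = (0,1)²`. -/
def Q0 : Set Plane := Set.Ioo (0 : ℝ) 1 ×ˢ Set.Ioo (0 : ℝ) 1

/-- `E^N_N(α)`, the Neumann energy on the unit square. -/
def EN (N : ℕ) (α : ℝ) : ℝ := neumannE N α Q0

/-- `E^D_N(α)`, the Dirichlet energy on the unit square. -/
def ED (N : ℕ) (α : ℝ) : ℝ := dirichletE N α Q0

/-- One-particle density `ρ_Ψ` of a wave function of `n+1` particles. -/
def density (n : ℕ) (Ψ : Config (n + 1) → ℂ) (y : Plane) : ℝ :=
  (n + 1) * ∫ z : Config n, ‖Ψ (Fin.cons y z)‖ ^ 2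

theorem cs_interval (q : ℝ → ℝ) (hq : Continuous q) :
    (∫ t in (-π)..π, q t) ^ 2 ≤ 2 * π * ∫ t in (-π)..π, q t ^ 2 := by
  set c : ℝ := (∫ t in (-π)..π, q t) / (2 * π) with hc
  have hpi := Real.pi_pos
  have h0 : 0 ≤ ∫ t in (-π)..π, (q t - c) ^ 2 :=
    intervalIntegral.integral_nonneg (by linarith) (fun t _ => sq_nonneg _)
  have h1 : ∫ t in (-π)..π, (q t - c) ^ 2
      = (∫ t in (-π)..π, q t ^ 2) - 2 * c * (∫ t in (-π)..π, q t) + 2 * π * c ^ 2 := by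
    have : ∀ t, (q t - c) ^ 2 = q t ^ 2 - 2 * c * q t + c ^ 2 := fun t => by ring
    simp_rw [this]
    rw [intervalIntegral.integral_add, intervalIntegral.integral_sub,
      intervalIntegral.integral_const_mul, intervalIntegral.integral_const]
    · simp only [smul_eq_mul]; ring
    all_goals exact Continuous.intervalIntegrable (by fun_prop) _ _
  have h2 : ∫ t in (-π)..π, q t = c * (2 * π) := by rw [hc]; field_simp
  rw [h1, h2] at h0
  rw [h2]
  nlinarith

theorem circle_hardy (v v' : ℝ → ℂ) (a : ℝ → ℝ) (α : ℝ) (hv : ∀ t, HasDerivAt v (v' t) t)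
    (hv'c : Continuous v') (hvp : Function.Periodic v (2 * π))
    (hv'p : Function.Periodic v' (2 * π))
    (ha : Continuous a) (hap : Function.Periodic a (2 * π))
    (hwind : ∫ t in (-π)..π, a t = 2 * π * α) :
    (Real.sin (π * α) / π) ^ 2 * ∫ t in (-π)..π, ‖v t‖ ^ 2
      ≤ ∫ t in (-π)..π, ‖-Complex.I * v' t + (a t : ℂ) * v t‖ ^ 2 := by
  have hpi := Real.pi_pos
  have hvc : Continuous v := continuous_iff_continuousAt.2 fun t => (hv t).continuousAt
  set q : ℝ → ℝ := fun t => ‖-Complex.I * v' t + (a t : ℂ) * v t‖ with hq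
  have hqc : Continuous q := by
    have : Continuous fun t => (a t : ℂ) := Complex.continuous_ofReal.comp ha
    fun_prop
  have hqp : Function.Periodic q (2 * π) := fun t => by
    simp only [hq, hvp t, hv'p t, hap t]
  set Φ : ℝ → ℝ := fun t => ∫ τ in (0 : ℝ)..t, a τ with hΦ
  have hΦd : ∀ t, HasDerivAt Φ (a t) t := fun t =>
    intervalIntegral.integral_hasDerivAt_right (ha.intervalIntegrable _ _)
      ha.aestronglyMeasurable.stronglyMeasurableAtFilter ha.continuousAt
  have hΦp : ∀ t, Φ (t + 2 * π) = Φ t + 2 * π * α := by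
    intro t
    have h1 : Φ t + ∫ τ in t..(t + 2 * π), a τ = Φ (t + 2 * π) :=
      intervalIntegral.integral_add_adjacent_intervals (ha.intervalIntegrable _ _)
        (ha.intervalIntegrable _ _)
    have h2 := hap.intervalIntegral_add_eq t (-π)
    rw [show -π + 2 * π = π by ring, hwind] at h2
    rw [← h1, h2]
  set w : ℝ → ℂ := fun t => v t * Complex.exp (Complex.I * (Φ t : ℂ)) with hw
  set w' : ℝ → ℂ := fun t => v' t * Complex.exp (Complex.I * (Φ t : ℂ)) +
    v t * (Complex.exp (Complex.I * (Φ t : ℂ)) * (Complex.I * (a t : ℂ))) with hw'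
  have hwd : ∀ t, HasDerivAt w (w' t) t := by
    intro t
    exact (hv t).mul (((hΦd t).ofReal_comp.const_mul Complex.I).cexp)
  have hexp : ∀ x : ℝ, ‖Complex.exp (Complex.I * (x : ℂ))‖ = 1 := by
    intro x; rw [mul_comm]; exact Complex.norm_exp_ofReal_mul_I x
  have hw'n : ∀ t, ‖w' t‖ = q t := by
    intro t
    have : w' t = Complex.I * (-Complex.I * v' t + (a t : ℂ) * v t) *
        Complex.exp (Complex.I * (Φ t : ℂ)) := by
      simp only [hw']
      linear_combination (v' t * Complex.exp (Complex.I * (Φ t : ℂ))) * Complex.I_sq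
    rw [this, norm_mul, norm_mul, hexp, Complex.norm_I]; simp [hq]
  have hΦc : Continuous Φ := continuous_iff_continuousAt.2 fun t => (hΦd t).continuousAt
  have hw'c : Continuous w' := by
    have h1 : Continuous fun t => (a t : ℂ) := Complex.continuous_ofReal.comp ha
    have h2 : Continuous fun t => (Φ t : ℂ) := Complex.continuous_ofReal.comp hΦc
    fun_prop
  have key : ∀ t, 2 * |Real.sin (π * α)| * ‖v t‖ ≤ ∫ τ in (-π)..π, q τ := by
    intro t
    have h1 : ∫ τ in t..(t + 2 * π), w' τ = w (t + 2 * π) - w t :=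
      intervalIntegral.integral_eq_sub_of_hasDerivAt (fun τ _ => hwd τ)
        (hw'c.intervalIntegrable _ _)
    have h2 : w (t + 2 * π) - w t = w t * (Complex.exp (Complex.I * ((2 * π * α : ℝ) : ℂ)) - 1) := by
      simp only [hw, hvp t, hΦp t]
      rw [Complex.ofReal_add, mul_add, Complex.exp_add]; ring
    have h3 : ‖w (t + 2 * π) - w t‖ = 2 * |Real.sin (π * α)| * ‖v t‖ := by
      rw [h2, norm_mul, Complex.norm_exp_I_mul_ofReal_sub_one]
      simp only [hw, norm_mul, hexp, Real.norm_eq_abs]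
      rw [show 2 * π * α / 2 = π * α by ring]; simp; ring
    have h4 : ‖∫ τ in t..(t + 2 * π), w' τ‖ ≤ ∫ τ in t..(t + 2 * π), ‖w' τ‖ :=
      intervalIntegral.norm_integral_le_integral_norm (by linarith)
    have h5 := hqp.intervalIntegral_add_eq t (-π)
    rw [show -π + 2 * π = π by ring] at h5
    rw [h1, h3] at h4
    simp_rw [hw'n] at h4
    rwa [h5] at h4
  have hQ := cs_interval q hqc
  set Q := ∫ τ in (-π)..π, q τ
  have key2 : ∀ t, ‖v t‖ ^ 2 * (4 * Real.sin (π * α) ^ 2) ≤ Q ^ 2 := by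
    intro t
    have := pow_le_pow_left₀ (by positivity) (key t) 2
    rw [mul_pow, mul_pow, sq_abs] at this
    linarith
  have key3 : (∫ t in (-π)..π, ‖v t‖ ^ 2 * (4 * Real.sin (π * α) ^ 2)) ≤ ∫ t in (-π)..π, Q ^ 2 :=
    intervalIntegral.integral_mono (by linarith)
      (Continuous.intervalIntegrable (by fun_prop) _ _)
      (Continuous.intervalIntegrable (by fun_prop) _ _) key2
  rw [intervalIntegral.integral_mul_const, intervalIntegral.integral_const] at key3
  simp only [smul_eq_mul] at key3
  have : (Real.sin (π * α) / π) ^ 2 * ∫ t in (-π)..π, ‖v t‖ ^ 2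
      = ((∫ t in (-π)..π, ‖v t‖ ^ 2) * (4 * Real.sin (π * α) ^ 2)) / (4 * π ^ 2) := by
    field_simp
  rw [this, div_le_iff₀ (by positivity)]
  nlinarith

/-- Polar parametrisation around `p`. -/
def ppt (p : Plane) (r θ : ℝ) : Plane := (p.1 + r * Real.cos θ, p.2 + r * Real.sin θ)

/-- Open Euclidean disc. -/
def edisc (p : Plane) (R : ℝ) : Set Plane := {z | (z.1 - p.1) ^ 2 + (z.2 - p.2) ^ 2 < R ^ 2}

theorem continuous_ppt (p : Plane) : Continuous (fun q : ℝ × ℝ => ppt p q.1 q.2) := by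
  unfold ppt; fun_prop

theorem isOpen_edisc (p : Plane) (R : ℝ) : IsOpen (edisc p R) := by
  unfold edisc
  exact isOpen_lt (by fun_prop) (by fun_prop)

theorem disc_integral (p : Plane) (R : ℝ) (hR : 0 < R) (F : Plane → ℝ) (hF : Continuous F) :
    ∫ z in edisc p R, F z = ∫ r in (0 : ℝ)..R, ∫ θ in (-π)..π, r * F (ppt p r θ) := by
  have hpi := Real.pi_pos
  have hm : MeasurableSet (edisc p R) := (isOpen_edisc p R).measurableSet
  rw [← integral_indicator hm]
  rw [← integral_add_left_eq_self (μ := (volume : Measure Plane)) _ p]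
  rw [← integral_comp_polarCoord_symm]
  have h1 : ∀ q ∈ polarCoord.target, q.1 • (edisc p R).indicator F (p + polarCoord.symm q)
      = (Ioo 0 R ×ˢ Ioo (-π) π).indicator (fun q => q.1 * F (ppt p q.1 q.2)) q := by
    intro q hq
    simp only [polarCoord_target, mem_prod, mem_Ioi] at hq
    have h2 : p + polarCoord.symm q = ppt p q.1 q.2 := by
      simp only [polarCoord_symm_apply, ppt]; rfl
    rw [h2]
    have h3 : ppt p q.1 q.2 ∈ edisc p R ↔ q ∈ (Ioo 0 R ×ˢ Ioo (-π) π) := by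
      simp only [edisc, ppt, mem_ofPred_eq, mem_prod, hq.2, and_true, mem_Ioo, hq.1, true_and,
        add_sub_cancel_left]
      rw [show (q.1 * Real.cos q.2) ^ 2 + (q.1 * Real.sin q.2) ^ 2 = q.1 ^ 2 by
        nlinarith [Real.sin_sq_add_cos_sq q.2]]
      constructor
      · intro h; nlinarith [hq.1]
      · intro h; nlinarith [hq.1]
    by_cases h : q ∈ (Ioo 0 R ×ˢ Ioo (-π) π)
    · rw [indicator_of_mem h, indicator_of_mem (h3.2 h)]; rfl
    · rw [indicator_of_notMem h, indicator_of_notMem (fun h' => h (h3.1 h'))]; simp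
  rw [setIntegral_congr_fun polarCoord.open_target.measurableSet h1]
  have hms : MeasurableSet (Ioo 0 R ×ˢ Ioo (-π) π) := measurableSet_Ioo.prod measurableSet_Ioo
  rw [setIntegral_indicator hms]
  have h4 : polarCoord.target ∩ (Ioo 0 R ×ˢ Ioo (-π) π) = Ioo 0 R ×ˢ Ioo (-π) π := by
    ext q; simp only [polarCoord_target, mem_inter_iff, mem_prod, mem_Ioi, mem_Ioo]; tauto
  rw [h4]
  have hc : Continuous (fun q : ℝ × ℝ => q.1 * F (ppt p q.1 q.2)) :=
    continuous_fst.mul (hF.comp (continuous_ppt p))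
  rw [Measure.volume_eq_prod, setIntegral_prod]
  · rw [intervalIntegral.integral_of_le hR.le, integral_Ioc_eq_integral_Ioo]
    refine setIntegral_congr_fun measurableSet_Ioo fun r _ => ?_
    simp only
    rw [intervalIntegral.integral_of_le (by linarith), integral_Ioc_eq_integral_Ioo]
  · rw [← Measure.volume_eq_prod]
    exact (hc.continuousOn.integrableOn_compact
      ((isCompact_Icc (a := 0) (b := R)).prod (isCompact_Icc (a := -π) (b := π)))).mono_set
      (prod_mono Ioo_subset_Icc_self Ioo_subset_Icc_self)

/-- Real part identity behind the diamagnetic inequality. -/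
theorem diamag (u du D : ℂ) (A : ℝ) (h : D = -Complex.I * du + (A : ℂ) * u) :
    |2 * (u.re * du.re + u.im * du.im)| ≤ 2 * ‖u‖ * ‖D‖ := by
  have h1 : u.re * du.re + u.im * du.im = ((starRingEnd ℂ) u * (Complex.I * D)).re := by
    rw [h]; simp; ring
  rw [h1, abs_mul, abs_two, mul_assoc]
  have := Complex.abs_re_le_norm ((starRingEnd ℂ) u * (Complex.I * D))
  rw [norm_mul, norm_mul, Complex.norm_I, one_mul, RCLike.norm_conj] at this
  linarith

/-- derivative of `‖u‖²` along a curve. -/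
theorem hasDerivAt_normSq (u : ℝ → ℂ) (du : ℂ) (t : ℝ) (h : HasDerivAt u du t) :
    HasDerivAt (fun t => ‖u t‖ ^ 2) (2 * ((u t).re * du.re + (u t).im * du.im)) t := by
  have := h.norm_sq
  convert this using 1
  simp [Complex.inner]; ring

theorem polar_hardy (u : Plane → ℂ) (hu : ContDiff ℝ 1 u) (D1 D2 : Plane → ℂ)
    (hD1 : Continuous D1) (hD2 : Continuous D2) (A : Plane → Plane)
    (h1 : ∀ z, D1 z = -Complex.I * fderiv ℝ u z (1, 0) + ((A z).1 : ℂ) * u z)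
    (h2 : ∀ z, D2 z = -Complex.I * fderiv ℝ u z (0, 1) + ((A z).2 : ℂ) * u z)
    (p : Plane) (R : ℝ) (hR : 0 < R) (hup : u p = 0) (α s : ℝ) (hs : s = Real.sin (π * α) / π)
    (hs0 : 0 ≤ s)
    (hAc : ∀ r ∈ Ioo 0 R, Continuous (fun θ => A (ppt p r θ)))
    (hAi : ∀ r ∈ Ioo 0 R, ∫ θ in (-π)..π, r * (-Real.sin θ * (A (ppt p r θ)).1
      + Real.cos θ * (A (ppt p r θ)).2) = 2 * π * α) :
    s * ∫ z in edisc p R, ‖u z‖ ^ 2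
      ≤ R ^ 2 / 2 * ∫ z in edisc p R, (‖D1 z‖ ^ 2 + ‖D2 z‖ ^ 2) := by
  have hpi := Real.pi_pos
  have huc : Continuous u := hu.continuous
  have hdu : Differentiable ℝ u := hu.differentiable (by norm_num)
  have hfc : Continuous (fderiv ℝ u) := hu.continuous_fderiv (by norm_num)
  set e : Plane → ℝ := fun z => ‖D1 z‖ ^ 2 + ‖D2 z‖ ^ 2 with he
  have hec : Continuous e := by fun_prop
  set E : ℝ → ℝ := fun r => ∫ θ in (-π)..π, r * e (ppt p r θ) with hE
  have hpc : ∀ r, Continuous (fun θ => ppt p r θ) := fun r => by unfold ppt; fun_prop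
  have hpr : ∀ θ, Continuous (fun r => ppt p r θ) := fun r => by unfold ppt; fun_prop
  -- radial derivative
  set dr : ℝ → ℝ → ℂ := fun r θ => fderiv ℝ u (ppt p r θ) (Real.cos θ, Real.sin θ) with hdr
  set g' : ℝ → ℝ → ℝ := fun r θ => 2 * ((u (ppt p r θ)).re * (dr r θ).re
    + (u (ppt p r θ)).im * (dr r θ).im) with hg'
  have hdrc : Continuous (fun q : ℝ × ℝ => dr q.1 q.2) := by
    have := hfc.comp (continuous_ppt p)
    exact this.clm_apply (by fun_prop)
  have hg'c : Continuous (fun q : ℝ × ℝ => g' q.1 q.2) := by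
    have h3 := huc.comp (continuous_ppt p)
    have h4 : Continuous (fun q : ℝ × ℝ => (u (ppt p q.1 q.2)).re) := Complex.continuous_re.comp h3
    have h5 : Continuous (fun q : ℝ × ℝ => (u (ppt p q.1 q.2)).im) := Complex.continuous_im.comp h3
    have h6 : Continuous (fun q : ℝ × ℝ => (dr q.1 q.2).re) := Complex.continuous_re.comp hdrc
    have h7 : Continuous (fun q : ℝ × ℝ => (dr q.1 q.2).im) := Complex.continuous_im.comp hdrc
    exact continuous_const.mul ((h4.mul h6).add (h5.mul h7))
  have hderr : ∀ r θ, HasDerivAt (fun r => u (ppt p r θ)) (dr r θ) r := by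
    intro r θ
    have ha : HasDerivAt (fun r => ppt p r θ) (Real.cos θ, Real.sin θ) r := by
      unfold ppt
      refine HasDerivAt.prodMk ?_ ?_
      · simpa using ((hasDerivAt_id r).mul_const (Real.cos θ)).const_add p.1
      · simpa using ((hasDerivAt_id r).mul_const (Real.sin θ)).const_add p.2
    exact (hdu _).hasFDerivAt.comp_hasDerivAt r ha
  have hpp : ∀ θ, ppt p 0 θ = p := fun θ => by simp [ppt]
  have hrad : ∀ r θ, ‖u (ppt p r θ)‖ ^ 2 = ∫ ρ in (0 : ℝ)..r, g' ρ θ := by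
    intro r θ
    rw [intervalIntegral.integral_eq_sub_of_hasDerivAt
      (fun ρ _ => hasDerivAt_normSq _ _ ρ (hderr ρ θ))]
    · simp [hpp, hup]
    · exact (hg'c.comp (continuous_id.prodMk continuous_const)).intervalIntegrable _ _
  -- angular inequality at fixed radius
  have hang : ∀ r ∈ Ioo 0 R, s * ∫ θ in (-π)..π, g' r θ ≤ E r := by
    intro r hr
    have hr0 : 0 < r := hr.1
    set v : ℝ → ℂ := fun θ => u (ppt p r θ) with hv
    set v' : ℝ → ℂ := fun θ => fderiv ℝ u (ppt p r θ) (r * -Real.sin θ, r * Real.cos θ) with hv'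
    set a : ℝ → ℝ := fun θ => r * (-Real.sin θ * (A (ppt p r θ)).1
      + Real.cos θ * (A (ppt p r θ)).2) with ha
    have hpper : Function.Periodic (fun θ => ppt p r θ) (2 * π) := fun θ => by
      simp [ppt]
    have hvc : Continuous v := huc.comp (hpc r)
    have hv'c : Continuous v' := (hfc.comp (hpc r)).clm_apply (by fun_prop)
    have hac : Continuous a := by
      have := hAc r hr
      have h3 : Continuous fun θ => (A (ppt p r θ)).1 := continuous_fst.comp this
      have h4 : Continuous fun θ => (A (ppt p r θ)).2 := continuous_snd.comp this
      fun_prop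
    have hch := circle_hardy v v' a α (by
      intro θ
      have hb : HasDerivAt (fun θ => ppt p r θ) (r * -Real.sin θ, r * Real.cos θ) θ := by
        unfold ppt
        refine HasDerivAt.prodMk ?_ ?_
        · exact ((Real.hasDerivAt_cos θ).const_mul r).const_add p.1
        · exact ((Real.hasDerivAt_sin θ).const_mul r).const_add p.2
      exact (hdu _).hasFDerivAt.comp_hasDerivAt θ hb) hv'c
      (fun θ => by have := hpper θ; simp only at this; simp only [hv, this])
      (fun θ => by have := hpper θ; simp only at this; simp only [hv', this]; simp) hac
      (fun θ => by have := hpper θ; simp only at this; simp only [ha, this]; simp) (hAi r hr)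
    rw [← hs] at hch
    -- radial and tangential derivatives
    set Dr : ℝ → ℂ := fun θ => (Real.cos θ : ℂ) * D1 (ppt p r θ) + (Real.sin θ : ℂ) * D2 (ppt p r θ)
      with hDr
    set Dt : ℝ → ℂ := fun θ => -(Real.sin θ : ℂ) * D1 (ppt p r θ) + (Real.cos θ : ℂ) * D2 (ppt p r θ)
      with hDt
    have hlin : ∀ (θ x y : ℝ), fderiv ℝ u (ppt p r θ) (x, y)
        = (x : ℂ) * fderiv ℝ u (ppt p r θ) (1, 0) + (y : ℂ) * fderiv ℝ u (ppt p r θ) (0, 1) := by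
      intro θ x y
      have : ((x, y) : Plane) = x • ((1, 0) : Plane) + y • ((0, 1) : Plane) := by
        simp
      rw [this, map_add, map_smul, map_smul]; simp
    have hDt' : ∀ θ, -Complex.I * v' θ + (a θ : ℂ) * v θ = (r : ℂ) * Dt θ := by
      intro θ
      simp only [hv', ha, hv, hDt, h1, h2, hlin θ (r * -Real.sin θ)]
      push_cast; ring
    have hDr' : ∀ θ, Dr θ = -Complex.I * dr r θ + ((Real.cos θ * (A (ppt p r θ)).1
        + Real.sin θ * (A (ppt p r θ)).2 : ℝ) : ℂ) * v θ := by
      intro θ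
      simp only [hdr, hv, hDr, h1, h2, hlin θ (Real.cos θ)]
      push_cast; ring
    have hDD : ∀ θ, ‖Dr θ‖ ^ 2 + ‖Dt θ‖ ^ 2 = e (ppt p r θ) := by
      intro θ
      have hsc := Real.sin_sq_add_cos_sq θ
      simp only [he, hDr, hDt, ← Complex.normSq_eq_norm_sq, Complex.normSq_apply, Complex.add_re,
        Complex.add_im, Complex.mul_re, Complex.mul_im, Complex.neg_re, Complex.neg_im,
        Complex.ofReal_re, Complex.ofReal_im]
      linear_combination ((D1 (ppt p r θ)).re ^ 2 + (D1 (ppt p r θ)).im ^ 2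
        + (D2 (ppt p r θ)).re ^ 2 + (D2 (ppt p r θ)).im ^ 2) * hsc
    have hDrc : Continuous Dr := by
      have h3 := hD1.comp (hpc r)
      have h4 := hD2.comp (hpc r)
      simp only [Function.comp_def] at h3 h4
      fun_prop
    have hDtc : Continuous Dt := by
      have h3 := hD1.comp (hpc r)
      have h4 := hD2.comp (hpc r)
      simp only [Function.comp_def] at h3 h4
      fun_prop
    have hpt : ∀ θ, s * g' r θ ≤ r * ‖Dr θ‖ ^ 2 + s ^ 2 / r * ‖v θ‖ ^ 2 := by
      intro θ
      have h3 := (le_abs_self _).trans (diamag _ _ _ _ (hDr' θ))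
      have h4 : s * g' r θ ≤ s * (2 * ‖v θ‖ * ‖Dr θ‖) := mul_le_mul_of_nonneg_left h3 hs0
      have h5 : 0 ≤ (r * ‖Dr θ‖ - s * ‖v θ‖) ^ 2 / r := by positivity
      have h6 : (r * ‖Dr θ‖ - s * ‖v θ‖) ^ 2 / r
        = r * ‖Dr θ‖ ^ 2 + s ^ 2 / r * ‖v θ‖ ^ 2 - s * (2 * ‖v θ‖ * ‖Dr θ‖) := by
        field_simp; ring
      linarith
    have hg1 : Continuous (fun θ => g' r θ) := hg'c.comp (continuous_const.prodMk continuous_id)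
    have hI1 : ∫ θ in (-π)..π, s * g' r θ ≤
        ∫ θ in (-π)..π, (r * ‖Dr θ‖ ^ 2 + s ^ 2 / r * ‖v θ‖ ^ 2) :=
      intervalIntegral.integral_mono (by linarith)
        (Continuous.intervalIntegrable (by fun_prop) _ _)
        (Continuous.intervalIntegrable (by fun_prop) _ _) hpt
    have hI1a : ∫ θ in (-π)..π, s * g' r θ = s * ∫ θ in (-π)..π, g' r θ :=
      intervalIntegral.integral_const_mul _ _
    have hI1b : ∫ θ in (-π)..π, (r * ‖Dr θ‖ ^ 2 + s ^ 2 / r * ‖v θ‖ ^ 2)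
        = r * (∫ θ in (-π)..π, ‖Dr θ‖ ^ 2) + s ^ 2 / r * ∫ θ in (-π)..π, ‖v θ‖ ^ 2 := by
      rw [intervalIntegral.integral_add
        (Continuous.intervalIntegrable (by fun_prop) _ _)
        (Continuous.intervalIntegrable (by fun_prop) _ _), intervalIntegral.integral_const_mul,
        intervalIntegral.integral_const_mul]
    rw [hI1a, hI1b] at hI1
    have hI2 : (∫ θ in (-π)..π, ‖-Complex.I * v' θ + (a θ : ℂ) * v θ‖ ^ 2)
        = r ^ 2 * ∫ θ in (-π)..π, ‖Dt θ‖ ^ 2 := by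
      rw [← intervalIntegral.integral_const_mul]
      congr 1; ext θ
      rw [hDt' θ, norm_mul, mul_pow, Complex.norm_real, Real.norm_eq_abs, sq_abs]
    have hI3 : E r = r * (∫ θ in (-π)..π, ‖Dr θ‖ ^ 2) + r * ∫ θ in (-π)..π, ‖Dt θ‖ ^ 2 := by
      rw [← intervalIntegral.integral_const_mul, ← intervalIntegral.integral_const_mul,
        ← intervalIntegral.integral_add
        (Continuous.intervalIntegrable (by fun_prop) _ _)
        (Continuous.intervalIntegrable (by fun_prop) _ _)]
      simp only [hE]
      congr 1; ext θ; rw [← hDD θ]; ring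
    rw [hI2] at hch
    have hI4 : s ^ 2 / r * ∫ θ in (-π)..π, ‖v θ‖ ^ 2 ≤ r * ∫ θ in (-π)..π, ‖Dt θ‖ ^ 2 := by
      rw [div_mul_eq_mul_div, div_le_iff₀ hr0]
      linarith
    rw [hI3]; linarith
  have hEc : Continuous E := by
    have hc : Continuous (Function.uncurry fun r θ => r * e (ppt p r θ)) :=
      continuous_fst.mul (hec.comp (continuous_ppt p))
    exact intervalIntegral.continuous_parametric_intervalIntegral_of_continuous' hc _ _
  have hEn : ∀ r, 0 ≤ r → 0 ≤ E r := by
    intro r hr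
    exact intervalIntegral.integral_nonneg (by linarith) (fun θ _ => by positivity)
  have hdisc : ∫ z in edisc p R, e z = ∫ r in (0 : ℝ)..R, E r := disc_integral p R hR e hec
  have hG : ∀ r ∈ Ioo 0 R, s * ∫ θ in (-π)..π, ‖u (ppt p r θ)‖ ^ 2 ≤ ∫ z in edisc p R, e z := by
    intro r hr
    have h3 : ∫ θ in (-π)..π, ‖u (ppt p r θ)‖ ^ 2 = ∫ ρ in (0 : ℝ)..r, ∫ θ in (-π)..π, g' ρ θ := by
      simp_rw [hrad r]
      rw [intervalIntegral_intervalIntegral_swap]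
      refine (hg'c.comp continuous_swap).continuousOn.integrableOn_compact
        ((isCompact_uIcc (a := -π) (b := π)).prod (isCompact_uIcc (a := 0) (b := r))) |>.mono_set ?_
      exact prod_mono uIoc_subset_uIcc uIoc_subset_uIcc
    rw [h3, ← intervalIntegral.integral_const_mul, hdisc]
    have h4 : ∫ ρ in (0 : ℝ)..r, s * ∫ θ in (-π)..π, g' ρ θ ≤ ∫ ρ in (0 : ℝ)..r, E ρ := by
      refine intervalIntegral.integral_mono_on_of_le_Ioo hr.1.le ?_ (hEc.intervalIntegrable _ _) ?_
      · apply Continuous.intervalIntegrable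
        exact continuous_const.mul
          (intervalIntegral.continuous_parametric_intervalIntegral_of_continuous' hg'c _ _)
      · intro ρ hρ; exact hang ρ ⟨hρ.1, hρ.2.trans hr.2⟩
    have h5 : (∫ ρ in (0 : ℝ)..r, E ρ) + ∫ ρ in r..R, E ρ = ∫ ρ in (0 : ℝ)..R, E ρ :=
      intervalIntegral.integral_add_adjacent_intervals (hEc.intervalIntegrable _ _)
        (hEc.intervalIntegrable _ _)
    have h6 : 0 ≤ ∫ ρ in r..R, E ρ :=
      intervalIntegral.integral_nonneg hr.2.le (fun ρ hρ => hEn ρ (hr.1.le.trans hρ.1))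
    linarith
  rw [disc_integral p R hR (fun z => ‖u z‖ ^ 2) (by fun_prop)]
  rw [← intervalIntegral.integral_const_mul]
  have hfin : ∫ r in (0 : ℝ)..R, s * ∫ θ in (-π)..π, r * ‖u (ppt p r θ)‖ ^ 2
      ≤ ∫ r in (0 : ℝ)..R, r * ∫ z in edisc p R, e z := by
    refine intervalIntegral.integral_mono_on_of_le_Ioo hR.le ?_ ?_ ?_
    · apply Continuous.intervalIntegrable
      refine continuous_const.mul ?_
      refine intervalIntegral.continuous_parametric_intervalIntegral_of_continuous'
        (f := fun r θ => r * ‖u (ppt p r θ)‖ ^ 2) ?_ _ _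
      have := huc.comp (continuous_ppt p)
      exact continuous_fst.mul ((continuous_norm.comp this).pow 2)
    · exact Continuous.intervalIntegrable (by fun_prop) _ _
    · intro r hr
      rw [intervalIntegral.integral_const_mul]
      have := mul_le_mul_of_nonneg_left (hG r hr) hr.1.le
      linarith
  refine hfin.trans (le_of_eq ?_)
  rw [intervalIntegral.integral_mul_const, integral_id]; ring

theorem circ_in (p : Plane) (r : ℝ) (hr : 0 < r) :
    ∫ θ in (-π)..π, r * (-Real.sin θ * (perpInv (ppt p r θ - p)).1
      + Real.cos θ * (perpInv (ppt p r θ - p)).2) = 2 * π := by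
  have : ∀ θ, r * (-Real.sin θ * (perpInv (ppt p r θ - p)).1
      + Real.cos θ * (perpInv (ppt p r θ - p)).2) = 1 := by
    intro θ
    have hsc := Real.sin_sq_add_cos_sq θ
    simp only [perpInv, ppt, Prod.fst_sub, Prod.snd_sub, add_sub_cancel_left]
    rw [show (r * Real.cos θ) ^ 2 + (r * Real.sin θ) ^ 2 = r ^ 2 by nlinarith]
    field_simp
    linarith
  simp_rw [this]
  simp; ring

theorem ppt_sub_ne (p w : Plane) (r : ℝ) (hw : r ^ 2 < (w.1 - p.1) ^ 2 + (w.2 - p.2) ^ 2)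
    (θ : ℝ) : ((ppt p r θ - w).1) ^ 2 + ((ppt p r θ - w).2) ^ 2 ≠ 0 := by
  intro h
  have h1 : (ppt p r θ - w).1 = 0 := by nlinarith [sq_nonneg (ppt p r θ - w).1, sq_nonneg (ppt p r θ - w).2]
  have h2 : (ppt p r θ - w).2 = 0 := by nlinarith [sq_nonneg (ppt p r θ - w).1, sq_nonneg (ppt p r θ - w).2]
  simp only [ppt, Prod.fst_sub, Prod.snd_sub] at h1 h2
  have h3 : w.1 - p.1 = r * Real.cos θ := by linarith
  have h4 : w.2 - p.2 = r * Real.sin θ := by linarith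
  rw [h3, h4] at hw
  nlinarith [Real.sin_sq_add_cos_sq θ]

theorem continuous_perpInv_comp {X : Type*} [TopologicalSpace X] (f : X → Plane)
    (hf : Continuous f) (h : ∀ x, (f x).1 ^ 2 + (f x).2 ^ 2 ≠ 0) :
    Continuous (fun x => perpInv (f x)) := by
  unfold perpInv
  have h1 : Continuous fun x => (f x).1 := continuous_fst.comp hf
  have h2 : Continuous fun x => (f x).2 := continuous_snd.comp hf
  exact ((h2.neg).div (by fun_prop) h).prodMk (h1.div (by fun_prop) h)

theorem continuous_ppt2 (p : Plane) (r : ℝ) : Continuous (fun θ => ppt p r θ) := by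
  unfold ppt; fun_prop

theorem circ_out (p w : Plane) (r : ℝ) (hr : 0 < r)
    (hw : r ^ 2 < (w.1 - p.1) ^ 2 + (w.2 - p.2) ^ 2) :
    ∫ θ in (-π)..π, r * (-Real.sin θ * (perpInv (ppt p r θ - w)).1
      + Real.cos θ * (perpInv (ppt p r θ - w)).2) = 0 := by
  set c : ℂ := ⟨p.1, p.2⟩ with hc
  set W : ℂ := ⟨w.1, w.2⟩ with hW
  have hWout : ∀ z ∈ Metric.closedBall c r, z - W ≠ 0 := by
    intro z hz h0
    rw [sub_eq_zero] at h0
    rw [Metric.mem_closedBall, Complex.dist_eq, h0] at hz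
    have h1 : ‖W - c‖ ^ 2 ≤ r ^ 2 := pow_le_pow_left₀ (norm_nonneg _) hz 2
    rw [← Complex.normSq_eq_norm_sq, Complex.normSq_apply] at h1
    simp only [hW, hc, Complex.sub_re, Complex.sub_im] at h1
    nlinarith
  have h0 : (∮ z in C(c, r), (z - W)⁻¹) = 0 := by
    apply Complex.circleIntegral_eq_zero_of_differentiable_on_off_countable hr.le countable_empty
    · exact ContinuousOn.inv₀ (by fun_prop) hWout
    · intro z hz
      exact DifferentiableAt.inv (by fun_prop) (hWout z (Metric.ball_subset_closedBall hz.1))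
  set F : ℝ → ℝ := fun θ => r * (-Real.sin θ * (perpInv (ppt p r θ - w)).1
      + Real.cos θ * (perpInv (ppt p r θ - w)).2) with hF
  have hper : Function.Periodic F (2 * π) := fun θ => by simp [hF, ppt]
  have h2 := hper.intervalIntegral_add_eq (-π) 0
  rw [show -π + 2 * π = π by ring, zero_add] at h2
  rw [h2]
  have h3 : ∀ θ, F θ = Complex.imCLM (deriv (circleMap c r) θ • (circleMap c r θ - W)⁻¹) := by
    intro θ
    have hne := ppt_sub_ne p w r hw θ
    have h4 : circleMap c r θ - W = ⟨(ppt p r θ - w).1, (ppt p r θ - w).2⟩ := by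
      apply Complex.ext
      · simp [circleMap, ppt, hc, hW, Complex.exp_re]
      · simp [circleMap, ppt, hc, hW, Complex.exp_im]
    have h5 : deriv (circleMap c r) θ = ⟨-(r * Real.sin θ), r * Real.cos θ⟩ := by
      rw [deriv_circleMap]
      apply Complex.ext
      · simp [circleMap, Complex.exp_im]
      · simp [circleMap, Complex.exp_re]
    rw [h4, h5]
    simp only [Complex.imCLM_apply, smul_eq_mul, Complex.mul_im, Complex.inv_re, Complex.inv_im,
      Complex.normSq_apply, hF, perpInv]
    rw [sq, sq] at hne ⊢
    field_simp
  have hcont : Continuous fun θ => deriv (circleMap c r) θ • (circleMap c r θ - W)⁻¹ := by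
    simp_rw [deriv_circleMap]
    have h1 : Continuous fun θ => circleMap 0 r θ * Complex.I :=
      (continuous_circleMap 0 r).mul continuous_const
    have h2 : Continuous fun θ => (circleMap c r θ - W)⁻¹ :=
      Continuous.inv₀ ((continuous_circleMap c r).sub continuous_const)
        (fun θ => hWout _ (circleMap_mem_closedBall c hr.le θ))
    exact h1.smul h2
  simp_rw [h3]
  rw [ContinuousLinearMap.intervalIntegral_comp_comm _ (hcont.intervalIntegrable _ _)]
  rw [circleIntegral] at h0
  rw [h0]; simp

/-! one-dimensional estimates -/

theorem one_pt (φ φ' : ℝ → ℝ) (hd : ∀ t, HasDerivAt φ (φ' t) t) (hc : Continuous φ') (a b s t : ℝ)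
    (hab : a ≤ b) (hs : s ∈ Icc a b) (ht : t ∈ Icc a b) :
    φ t ≤ φ s + ∫ x in a..b, |φ' x| := by
  have h1 : ∫ x in s..t, φ' x = φ t - φ s :=
    intervalIntegral.integral_eq_sub_of_hasDerivAt (fun x _ => hd x) (hc.intervalIntegrable _ _)
  have h2 : |∫ x in s..t, φ' x| ≤ |(∫ x in s..t, |φ' x|)| := by
    have := intervalIntegral.norm_integral_le_abs_integral_norm (f := φ') (a := s) (b := t)
      (μ := volume)
    simpa only [Real.norm_eq_abs] using this
  have h3 : |(∫ x in s..t, |φ' x|)| ≤ |(∫ x in a..b, |φ' x|)| := by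
    apply intervalIntegral.abs_integral_mono_interval
    · rw [uIoc_of_le hab]
      rcases le_total s t with h | h
      · rw [uIoc_of_le h]; exact Ioc_subset_Ioc hs.1 ht.2
      · rw [uIoc_of_ge h]; exact Ioc_subset_Ioc ht.1 hs.2
    · exact Filter.Eventually.of_forall fun x => abs_nonneg _
    · exact hc.abs.intervalIntegrable _ _
  have h4 : |(∫ x in a..b, |φ' x|)| = ∫ x in a..b, |φ' x| :=
    abs_of_nonneg (intervalIntegral.integral_nonneg hab fun x _ => abs_nonneg _)
  have h5 := le_abs_self (∫ x in s..t, φ' x)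
  linarith

theorem one_avg (φ φ' : ℝ → ℝ) (hd : ∀ t, HasDerivAt φ (φ' t) t) (hc : Continuous φ')
    (a b c d t : ℝ) (hac : a ≤ c) (hcd : c ≤ d) (hdb : d ≤ b) (ht : t ∈ Icc a b) :
    (d - c) * φ t ≤ (∫ x in c..d, φ x) + (d - c) * ∫ x in a..b, |φ' x| := by
  have hφ : Continuous φ := continuous_iff_continuousAt.2 fun t => (hd t).continuousAt
  have h1 : ∫ s in c..d, φ t ≤ ∫ s in c..d, (φ s + ∫ x in a..b, |φ' x|) := by
    refine intervalIntegral.integral_mono_on hcd (by simp)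
      (Continuous.intervalIntegrable (by fun_prop) _ _) ?_
    intro s hs
    exact one_pt φ φ' hd hc a b s t (by linarith) ⟨by linarith [hs.1], by linarith [hs.2]⟩ ht
  rw [intervalIntegral.integral_add (hφ.intervalIntegrable _ _) (by simp)] at h1
  simpa using h1

theorem one_avg2 (φ φ' : ℝ → ℝ) (hd : ∀ t, HasDerivAt φ (φ' t) t) (hc : Continuous φ')
    (a b c d : ℝ) (hac : a ≤ c) (hcd : c ≤ d) (hdb : d ≤ b) :
    (d - c) * (∫ x in a..b, φ x) ≤ (b - a) * (∫ x in c..d, φ x)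
      + (b - a) * (d - c) * ∫ x in a..b, |φ' x| := by
  have hφ : Continuous φ := continuous_iff_continuousAt.2 fun t => (hd t).continuousAt
  have h1 : ∫ t in a..b, (d - c) * φ t ≤
      ∫ t in a..b, ((∫ x in c..d, φ x) + (d - c) * ∫ x in a..b, |φ' x|) := by
    refine intervalIntegral.integral_mono_on (by linarith)
      (Continuous.intervalIntegrable (by fun_prop) _ _) (by simp) ?_
    intro t ht
    exact one_avg φ φ' hd hc a b c d t hac hcd hdb ht
  rw [intervalIntegral.integral_const_mul, intervalIntegral.integral_const] at h1
  simp only [smul_eq_mul] at h1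
  linarith

/-! two-dimensional estimates -/

theorem prod_integrable (F : Plane → ℝ) (hF : Continuous F) (a a' b b' : ℝ) :
    IntegrableOn F (Ioc a a' ×ˢ Ioc b b') :=
  (hF.continuousOn.integrableOn_compact
      ((isCompact_Icc (a := a) (b := a')).prod (isCompact_Icc (a := b) (b := b')))).mono_set
      (prod_mono Ioc_subset_Icc_self Ioc_subset_Icc_self)

theorem fub1 (F : Plane → ℝ) (hF : Continuous F) (a a' b b' : ℝ) (ha : a ≤ a') (hb : b ≤ b') :
    ∫ z in Ioc a a' ×ˢ Ioc b b', F z = ∫ x in a..a', ∫ y in b..b', F (x, y) := by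
  rw [Measure.volume_eq_prod, setIntegral_prod]
  · simp_rw [intervalIntegral.integral_of_le ha, intervalIntegral.integral_of_le hb]
  · exact prod_integrable F hF a a' b b'

theorem fub2 (F : Plane → ℝ) (hF : Continuous F) (a a' b b' : ℝ) (ha : a ≤ a') (hb : b ≤ b') :
    ∫ z in Ioc a a' ×ˢ Ioc b b', F z = ∫ y in b..b', ∫ x in a..a', F (x, y) := by
  rw [fub1 F hF a a' b b' ha hb, intervalIntegral_intervalIntegral_swap]
  rw [uIoc_of_le ha, uIoc_of_le hb]
  exact prod_integrable F hF a a' b b'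

theorem cont_par1 (F : Plane → ℝ) (hF : Continuous F) (b b' : ℝ) :
    Continuous (fun x => ∫ y in b..b', F (x, y)) :=
  intervalIntegral.continuous_parametric_intervalIntegral_of_continuous'
    (f := fun x y => F (x, y)) hF _ _

theorem cont_par2 (F : Plane → ℝ) (hF : Continuous F) (a a' : ℝ) :
    Continuous (fun y => ∫ x in a..a', F (x, y)) :=
  intervalIntegral.continuous_parametric_intervalIntegral_of_continuous'
    (f := fun y x => F (x, y)) (hF.comp continuous_swap) _ _

theorem box_avg (g g1 g2 : Plane → ℝ) (hg : Continuous g) (hg1 : Continuous g1)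
    (hg2 : Continuous g2)
    (hd1 : ∀ x y, HasDerivAt (fun t => g (t, y)) (g1 (x, y)) x)
    (hd2 : ∀ x y, HasDerivAt (fun t => g (x, t)) (g2 (x, y)) y)
    (a b l c1 c2 k : ℝ) (hl : 0 < l) (hk : 0 < k) (h1 : a ≤ c1) (h1' : c1 + k ≤ a + l)
    (h2 : b ≤ c2) (h2' : c2 + k ≤ b + l) :
    k ^ 2 * (∫ z in Ioc a (a + l) ×ˢ Ioc b (b + l), g z) ≤
      l ^ 2 * (∫ z in Ioc c1 (c1 + k) ×ˢ Ioc c2 (c2 + k), g z)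
      + l * k ^ 2 * (∫ z in Ioc a (a + l) ×ˢ Ioc b (b + l), |g1 z|)
      + l ^ 2 * k * (∫ z in Ioc a (a + l) ×ˢ Ioc b (b + l), |g2 z|) := by
  have s1 : k * (∫ z in Ioc a (a + l) ×ˢ Ioc b (b + l), g z) ≤
      l * (∫ z in Ioc c1 (c1 + k) ×ˢ Ioc b (b + l), g z)
      + l * k * (∫ z in Ioc a (a + l) ×ˢ Ioc b (b + l), |g1 z|) := by
    rw [fub2 g hg _ _ _ _ (by linarith) (by linarith), fub2 g hg _ _ _ _ (by linarith) (by linarith),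
      fub2 (fun z => |g1 z|) hg1.abs _ _ _ _ (by linarith) (by linarith)]
    have c1' := cont_par2 g hg a (a + l)
    have c2' := cont_par2 g hg c1 (c1 + k)
    have c3' := cont_par2 (fun z => |g1 z|) hg1.abs a (a + l)
    rw [← intervalIntegral.integral_const_mul, ← intervalIntegral.integral_const_mul,
      ← intervalIntegral.integral_const_mul, ← intervalIntegral.integral_add
        (Continuous.intervalIntegrable (by fun_prop) _ _)
        (Continuous.intervalIntegrable (by fun_prop) _ _)]
    refine intervalIntegral.integral_mono (by linarith)
      (Continuous.intervalIntegrable (by fun_prop) _ _)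
      (Continuous.intervalIntegrable (by fun_prop) _ _) ?_
    intro y
    have := one_avg2 (fun t => g (t, y)) (fun t => g1 (t, y)) (fun x => hd1 x y)
      (hg1.comp (by fun_prop)) a (a + l) c1 (c1 + k) h1 (by linarith) h1'
    simpa using this
  have s2 : k * (∫ z in Ioc c1 (c1 + k) ×ˢ Ioc b (b + l), g z) ≤
      l * (∫ z in Ioc c1 (c1 + k) ×ˢ Ioc c2 (c2 + k), g z)
      + l * k * (∫ z in Ioc c1 (c1 + k) ×ˢ Ioc b (b + l), |g2 z|) := by
    rw [fub1 g hg _ _ _ _ (by linarith) (by linarith), fub1 g hg _ _ _ _ (by linarith) (by linarith),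
      fub1 (fun z => |g2 z|) hg2.abs _ _ _ _ (by linarith) (by linarith)]
    have c1' := cont_par1 g hg b (b + l)
    have c2' := cont_par1 g hg c2 (c2 + k)
    have c3' := cont_par1 (fun z => |g2 z|) hg2.abs b (b + l)
    rw [← intervalIntegral.integral_const_mul, ← intervalIntegral.integral_const_mul,
      ← intervalIntegral.integral_const_mul, ← intervalIntegral.integral_add
        (Continuous.intervalIntegrable (by fun_prop) _ _)
        (Continuous.intervalIntegrable (by fun_prop) _ _)]
    refine intervalIntegral.integral_mono (by linarith)
      (Continuous.intervalIntegrable (by fun_prop) _ _)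
      (Continuous.intervalIntegrable (by fun_prop) _ _) ?_
    intro x
    have := one_avg2 (fun t => g (x, t)) (fun t => g2 (x, t)) (fun y => hd2 x y)
      (hg2.comp (by fun_prop)) b (b + l) c2 (c2 + k) h2 (by linarith) h2'
    simpa using this
  have s3 : (∫ z in Ioc c1 (c1 + k) ×ˢ Ioc b (b + l), |g2 z|)
      ≤ ∫ z in Ioc a (a + l) ×ˢ Ioc b (b + l), |g2 z| := by
    refine setIntegral_mono_set (prod_integrable _ hg2.abs _ _ _ _)
      (Filter.Eventually.of_forall fun z => abs_nonneg _) ?_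
    exact LE.le.eventuallyLE (prod_mono (Ioc_subset_Ioc h1 h1') subset_rfl)
  have t1 := mul_le_mul_of_nonneg_left s1 hk.le
  have t2 := mul_le_mul_of_nonneg_left s2 hl.le
  have t3 := mul_le_mul_of_nonneg_left s3 (by positivity : 0 ≤ l ^ 2 * k)
  nlinarith

theorem vol_slab (W : Set ℝ) (c ρ : ℝ) (hρ : 0 ≤ ρ) (hW : ∀ t ∈ W, |t - c| ≤ ρ) :
    volume.real W ≤ 2 * ρ := by
  have : W ⊆ Icc (c - ρ) (c + ρ) := fun t ht => by
    have := abs_le.1 (hW t ht); constructor <;> linarith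
  have h := measureReal_mono this (μ := volume) (by simp)
  rw [Real.volume_real_Icc_of_le (by linarith)] at h
  linarith

theorem slab1 (g g1 : Plane → ℝ) (hg : Continuous g) (hg1 : Continuous g1) (hg0 : ∀ z, 0 ≤ g z)
    (hd1 : ∀ x y, HasDerivAt (fun t => g (t, y)) (g1 (x, y)) x)
    (a b l c ρ : ℝ) (hl : 0 < l) (hρ : 0 ≤ ρ) :
    l * (∫ z in (Ioc a (a + l) ×ˢ Ioc b (b + l)) ∩ {z | |z.1 - c| ≤ ρ}, g z) ≤
      2 * ρ * ((∫ z in Ioc a (a + l) ×ˢ Ioc b (b + l), g z)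
        + l * ∫ z in Ioc a (a + l) ×ˢ Ioc b (b + l), |g1 z|) := by
  set W : Set ℝ := Ioc a (a + l) ∩ {t | |t - c| ≤ ρ} with hW
  have hWm : MeasurableSet W := measurableSet_Ioc.inter
    (measurableSet_le (by fun_prop) (by fun_prop))
  have hset : (Ioc a (a + l) ×ˢ Ioc b (b + l)) ∩ {z : Plane | |z.1 - c| ≤ ρ}
      = W ×ˢ Ioc b (b + l) := by
    ext z; simp only [hW, mem_inter_iff, mem_prod, mem_ofPred_eq]; tauto
  rw [hset]
  have hsub : W ×ˢ Ioc b (b + l) ⊆ Ioc a (a + l) ×ˢ Ioc b (b + l) :=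
    prod_mono inter_subset_left subset_rfl
  set M : ℝ → ℝ := fun y => (∫ x in a..(a + l), g (x, y)) + l * ∫ x in a..(a + l), |g1 (x, y)| with hM
  have c1' := cont_par2 g hg a (a + l)
  have c3' := cont_par2 (fun z => |g1 z|) hg1.abs a (a + l)
  have hMc : Continuous M := by fun_prop
  have hM2 : Continuous (fun z : Plane => M z.2) := by fun_prop
  have hm : MeasurableSet (W ×ˢ Ioc b (b + l)) := hWm.prod measurableSet_Ioc
  have k1 : (∫ z in W ×ˢ Ioc b (b + l), l * g z) ≤ ∫ z in W ×ˢ Ioc b (b + l), M z.2 := by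
    refine setIntegral_mono_on
      ((prod_integrable _ (by fun_prop) _ _ _ _).mono_set hsub)
      ((prod_integrable _ hM2 _ _ _ _).mono_set hsub) hm ?_
    rintro ⟨x, y⟩ hz
    have hx : x ∈ Ioc a (a + l) := (hsub hz).1
    have := one_avg (fun t => g (t, y)) (fun t => g1 (t, y)) (fun x => hd1 x y)
      (hg1.comp (by fun_prop)) a (a + l) a (a + l) x le_rfl (by linarith) le_rfl
      (Ioc_subset_Icc_self hx)
    simpa [hM] using this
  rw [integral_const_mul] at k1
  refine k1.trans ?_
  have k2 : ∫ z in W ×ˢ Ioc b (b + l), M z.2 = volume.real W * ∫ y in Ioc b (b + l), M y := by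
    rw [Measure.volume_eq_prod, setIntegral_prod]
    · simp
    · exact (prod_integrable _ hM2 _ _ _ _).mono_set hsub
  have k3 : ∫ y in Ioc b (b + l), M y = (∫ z in Ioc a (a + l) ×ˢ Ioc b (b + l), g z)
        + l * ∫ z in Ioc a (a + l) ×ˢ Ioc b (b + l), |g1 z| := by
    rw [fub2 g hg _ _ _ _ (by linarith) (by linarith),
      fub2 (fun z => |g1 z|) hg1.abs _ _ _ _ (by linarith) (by linarith),
      ← intervalIntegral.integral_of_le (by linarith), ← intervalIntegral.integral_const_mul,
      ← intervalIntegral.integral_add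
        (Continuous.intervalIntegrable (by fun_prop) _ _)
        (Continuous.intervalIntegrable (by fun_prop) _ _)]
  rw [k2, k3]
  refine mul_le_mul_of_nonneg_right (vol_slab W c ρ hρ fun t ht => ht.2) ?_
  have := setIntegral_nonneg (μ := volume) (measurableSet_Ioc.prod measurableSet_Ioc :
    MeasurableSet (Ioc a (a + l) ×ˢ Ioc b (b + l))) (fun z _ => hg0 z)
  have := setIntegral_nonneg (μ := volume) (measurableSet_Ioc.prod measurableSet_Ioc :
    MeasurableSet (Ioc a (a + l) ×ˢ Ioc b (b + l))) (fun z _ => abs_nonneg (g1 z))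
  positivity

theorem slab2 (g g1 : Plane → ℝ) (hg : Continuous g) (hg1 : Continuous g1) (hg0 : ∀ z, 0 ≤ g z)
    (hd1 : ∀ x y, HasDerivAt (fun t => g (x, t)) (g1 (x, y)) y)
    (a b l c ρ : ℝ) (hl : 0 < l) (hρ : 0 ≤ ρ) :
    l * (∫ z in (Ioc a (a + l) ×ˢ Ioc b (b + l)) ∩ {z | |z.2 - c| ≤ ρ}, g z) ≤
      2 * ρ * ((∫ z in Ioc a (a + l) ×ˢ Ioc b (b + l), g z)
        + l * ∫ z in Ioc a (a + l) ×ˢ Ioc b (b + l), |g1 z|) := by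
  have key := slab1 (g ∘ Prod.swap) (g1 ∘ Prod.swap) (hg.comp continuous_swap)
    (hg1.comp continuous_swap) (fun z => hg0 _) (fun x y => hd1 y x) b a l c ρ hl hρ
  have sw : ∀ (F : Plane → ℝ) (S : Set Plane), ∫ z in S, F z
      = ∫ z in Prod.swap ⁻¹' S, (F ∘ Prod.swap) z := by
    intro F S
    have hmp : MeasurePreserving (Prod.swap : Plane → Plane) volume volume :=
      Measure.measurePreserving_swap
    exact (hmp.setIntegral_preimage_emb MeasurableEquiv.prodComm.measurableEmbedding F S).symm
  rw [sw g, sw g, sw (fun z => |g1 z|)]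
  have e1 : Prod.swap ⁻¹' (Ioc a (a + l) ×ˢ Ioc b (b + l)) = Ioc b (b + l) ×ˢ Ioc a (a + l) := by
    ext z; simp [and_comm]
  have e2 : Prod.swap ⁻¹' ((Ioc a (a + l) ×ˢ Ioc b (b + l)) ∩ {z : Plane | |z.2 - c| ≤ ρ})
      = (Ioc b (b + l) ×ˢ Ioc a (a + l)) ∩ {z : Plane | |z.1 - c| ≤ ρ} := by
    rw [preimage_inter, e1]; rfl
  rw [e1, e2]
  exact key

/-- Directional derivative of `‖u‖²`. -/
def gd (u : Plane → ℂ) (v z : Plane) : ℝ :=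
  2 * ((u z).re * (fderiv ℝ u z v).re + (u z).im * (fderiv ℝ u z v).im)

theorem continuous_gd (u : Plane → ℂ) (hu : ContDiff ℝ 1 u) (v : Plane) :
    Continuous (gd u v) := by
  have h1 : Continuous u := hu.continuous
  have hfc : Continuous (fderiv ℝ u) := hu.continuous_fderiv (by norm_num)
  have h2 : Continuous fun z => fderiv ℝ u z v := hfc.clm_apply continuous_const
  have h4 : Continuous (fun q => (u q).re) := Complex.continuous_re.comp h1
  have h5 : Continuous (fun q => (u q).im) := Complex.continuous_im.comp h1
  have h6 : Continuous (fun q => (fderiv ℝ u q v).re) := Complex.continuous_re.comp h2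
  have h7 : Continuous (fun q => (fderiv ℝ u q v).im) := Complex.continuous_im.comp h2
  exact continuous_const.mul ((h4.mul h6).add (h5.mul h7))

theorem hasDerivAt_g1 (u : Plane → ℂ) (hu : ContDiff ℝ 1 u) (x y : ℝ) :
    HasDerivAt (fun t => ‖u (t, y)‖ ^ 2) (gd u (1, 0) (x, y)) x := by
  have hdu : Differentiable ℝ u := hu.differentiable (by norm_num)
  have h1 : HasDerivAt (fun t : ℝ => ((t, y) : Plane)) (1, 0) x :=
    (hasDerivAt_id x).prodMk (hasDerivAt_const x y)
  exact hasDerivAt_normSq _ _ x ((hdu (x, y)).hasFDerivAt.comp_hasDerivAt x h1)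

theorem hasDerivAt_g2 (u : Plane → ℂ) (hu : ContDiff ℝ 1 u) (x y : ℝ) :
    HasDerivAt (fun t => ‖u (x, t)‖ ^ 2) (gd u (0, 1) (x, y)) y := by
  have hdu : Differentiable ℝ u := hu.differentiable (by norm_num)
  have h1 : HasDerivAt (fun t : ℝ => ((x, t) : Plane)) (0, 1) y :=
    (hasDerivAt_const y x).prodMk (hasDerivAt_id y)
  exact hasDerivAt_normSq _ _ y ((hdu (x, y)).hasFDerivAt.comp_hasDerivAt y h1)

theorem gd_le (u : Plane → ℂ) (D : ℂ) (A : ℝ) (v z : Plane) (τ : ℝ) (hτ : 0 < τ)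
    (h : D = -Complex.I * fderiv ℝ u z v + (A : ℂ) * u z) :
    |gd u v z| ≤ τ * ‖u z‖ ^ 2 + ‖D‖ ^ 2 / τ := by
  have h1 := diamag (u z) (fderiv ℝ u z v) D A h
  refine h1.trans ?_
  have h5 : 0 ≤ (τ * ‖u z‖ - ‖D‖) ^ 2 / τ := by positivity
  have h6 : (τ * ‖u z‖ - ‖D‖) ^ 2 / τ
        = τ * ‖u z‖ ^ 2 + ‖D‖ ^ 2 / τ - 2 * ‖u z‖ * ‖D‖ := by
        field_simp; ring
  linarith

theorem main_box_arith (I T G1 G2 q Q QE h l d s τ : ℝ) (hh : h = d * l)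
    (hτ : τ = h / (10 * l ^ 2)) (hl : 0 < l) (hd : 0 < d) (hs0 : 0 < s) (hT0 : 0 ≤ T)
    (hG10 : 0 ≤ G1) (hpol : s * Q ≤ (3 / 2 * h) ^ 2 / 2 * QE) (hq : q ≤ Q) (hed : QE ≤ T)
    (hbox : (2 * h) ^ 2 * I ≤ l ^ 2 * q + l * (2 * h) ^ 2 * G1 + l ^ 2 * (2 * h) * G2)
    (hgrad : G1 + G2 ≤ 2 * τ * I + T / τ) (h2hl : 2 * h ≤ l) :
    I ≤ l ^ 2 * (5 / (16 * s) + 6 / d ^ 2) * T := by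
  have hh0 : 0 < h := by rw [hh]; positivity
  have k1 : q ≤ 9 / (8 * s) * h ^ 2 * T := by
    have : s * q ≤ 9 / 8 * h ^ 2 * T := by
      have := mul_le_mul_of_nonneg_left hq hs0.le
      have := mul_le_mul_of_nonneg_left hed (by positivity : 0 ≤ (3 / 2 * h) ^ 2 / 2)
      linarith
    have e : 9 / (8 * s) * h ^ 2 * T = (9 / 8 * h ^ 2 * T) / s := by field_simp
    rw [e, le_div_iff₀ hs0]; linarith
  have k2 : 4 * h ^ 2 * I ≤ l ^ 2 * q + 2 * h * l ^ 2 * (G1 + G2) := by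
    have : l * (2 * h) ^ 2 * G1 ≤ 2 * h * l ^ 2 * G1 := by
      apply mul_le_mul_of_nonneg_right _ hG10
      have := mul_le_mul_of_nonneg_left h2hl (by positivity : 0 ≤ 2 * h * l)
      linarith
    linarith
  have k3 : 2 * h * l ^ 2 * (2 * τ * I + T / τ) = 4 / 10 * h ^ 2 * I + 20 * l ^ 4 * T := by
    rw [hτ]; field_simp; ring
  have k4 := mul_le_mul_of_nonneg_left hgrad (by positivity : 0 ≤ 2 * h * l ^ 2)
  have k5 := mul_le_mul_of_nonneg_left k1 (by positivity : 0 ≤ l ^ 2)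
  have k6 : 36 / 10 * h ^ 2 * I ≤ l ^ 2 * (9 / (8 * s) * h ^ 2 * T) + 20 * l ^ 4 * T := by linarith
  have k7 : 36 / 10 * h ^ 2 * (l ^ 2 * (5 / (16 * s) + 6 / d ^ 2) * T)
      = l ^ 2 * (9 / (8 * s) * h ^ 2 * T) + 36 / 10 * 6 * l ^ 4 * T := by
    rw [hh]; field_simp; ring
  have k8 : 0 ≤ l ^ 4 * T := by positivity
  have k9 : 36 / 10 * h ^ 2 * I ≤ 36 / 10 * h ^ 2 * (l ^ 2 * (5 / (16 * s) + 6 / d ^ 2) * T) := by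
    rw [k7]; linarith
  exact le_of_mul_le_mul_left k9 (by positivity)

theorem main_box (u : Plane → ℂ) (hu : ContDiff ℝ 1 u) (D1 D2 : Plane → ℂ)
    (hD1 : Continuous D1) (hD2 : Continuous D2) (A : Plane → Plane)
    (h1 : ∀ z, D1 z = -Complex.I * fderiv ℝ u z (1, 0) + ((A z).1 : ℂ) * u z)
    (h2 : ∀ z, D2 z = -Complex.I * fderiv ℝ u z (0, 1) + ((A z).2 : ℂ) * u z)
    (a b l d : ℝ) (hl : 0 < l) (hd : 0 < d)
    (p : Plane) (hp1 : a + 2 * d * l < p.1) (hp2 : p.1 + 2 * d * l < a + l)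
    (hp3 : b + 2 * d * l < p.2) (hp4 : p.2 + 2 * d * l < b + l)
    (hup : u p = 0) (α s : ℝ) (hs : s = Real.sin (π * α) / π)
    (hs0 : 0 < s)
    (hAc : ∀ r ∈ Ioo 0 (3 / 2 * (d * l)), Continuous (fun θ => A (ppt p r θ)))
    (hAi : ∀ r ∈ Ioo 0 (3 / 2 * (d * l)), ∫ θ in (-π)..π, r * (-Real.sin θ * (A (ppt p r θ)).1
      + Real.cos θ * (A (ppt p r θ)).2) = 2 * π * α) :
    ∫ z in Ioc a (a + l) ×ˢ Ioc b (b + l), ‖u z‖ ^ 2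
      ≤ l ^ 2 * (5 / (16 * s) + 6 / d ^ 2) *
        ∫ z in Ioc a (a + l) ×ˢ Ioc b (b + l), (‖D1 z‖ ^ 2 + ‖D2 z‖ ^ 2) := by
  set h : ℝ := d * l with hh
  have hh0 : 0 < h := by positivity
  have huc : Continuous u := hu.continuous
  have hg : Continuous (fun z => ‖u z‖ ^ 2) := by fun_prop
  have he : Continuous (fun z => ‖D1 z‖ ^ 2 + ‖D2 z‖ ^ 2) := by fun_prop
  have hpol := polar_hardy u hu D1 D2 hD1 hD2 A h1 h2 p (3 / 2 * h) (by positivity) hup α s hs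
    hs0.le hAc hAi
  have hbox := box_avg (fun z => ‖u z‖ ^ 2) (gd u (1, 0)) (gd u (0, 1)) hg (continuous_gd u hu _)
    (continuous_gd u hu _) (hasDerivAt_g1 u hu) (hasDerivAt_g2 u hu) a b l (p.1 - h) (p.2 - h)
    (2 * h) hl (by positivity) (by linarith) (by linarith) (by linarith) (by linarith)
  set B : Set Plane := Ioc a (a + l) ×ˢ Ioc b (b + l) with hB
  have hBm : MeasurableSet B := measurableSet_Ioc.prod measurableSet_Ioc
  have hq : (∫ z in Ioc (p.1 - h) (p.1 - h + 2 * h) ×ˢ Ioc (p.2 - h) (p.2 - h + 2 * h), ‖u z‖ ^ 2)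
      ≤ ∫ z in edisc p (3 / 2 * h), ‖u z‖ ^ 2 := by
    have hsub : Ioc (p.1 - h) (p.1 - h + 2 * h) ×ˢ Ioc (p.2 - h) (p.2 - h + 2 * h)
        ⊆ edisc p (3 / 2 * h) := by
      rintro z ⟨hz1, hz2⟩
      simp only [edisc, mem_ofPred_eq, mem_Ioc] at *
      have e1 : (z.1 - p.1) ^ 2 ≤ h ^ 2 := by
        exact sq_le_sq' (by linarith) (by linarith)
      have e2 : (z.2 - p.2) ^ 2 ≤ h ^ 2 := by
        exact sq_le_sq' (by linarith) (by linarith)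
      nlinarith
    refine setIntegral_mono_set ?_ (Filter.Eventually.of_forall fun z => by positivity)
      hsub.eventuallyLE
    refine (prod_integrable _ hg a (a + l) b (b + l)).mono_set ?_
    rintro z hz
    simp only [edisc, mem_ofPred_eq] at hz
    have e1 : |z.1 - p.1| < 3 / 2 * h := by
      apply abs_lt_of_sq_lt_sq _ (by positivity); nlinarith [sq_nonneg (z.2 - p.2)]
    have e2 : |z.2 - p.2| < 3 / 2 * h := by
      apply abs_lt_of_sq_lt_sq _ (by positivity); nlinarith [sq_nonneg (z.1 - p.1)]
    rw [abs_lt] at e1 e2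
    refine ⟨⟨?_, ?_⟩, ⟨?_, ?_⟩⟩ <;> linarith [e1.1, e1.2, e2.1, e2.2]
  have hed : (∫ z in edisc p (3 / 2 * h), (‖D1 z‖ ^ 2 + ‖D2 z‖ ^ 2))
      ≤ ∫ z in B, (‖D1 z‖ ^ 2 + ‖D2 z‖ ^ 2) := by
    refine setIntegral_mono_set (prod_integrable _ he a (a + l) b (b + l))
      (Filter.Eventually.of_forall fun z => by positivity) (LE.le.eventuallyLE ?_)
    intro z hz
    simp only [edisc, mem_ofPred_eq] at hz
    have e1 : |z.1 - p.1| < 3 / 2 * h := by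
      apply abs_lt_of_sq_lt_sq _ (by positivity); nlinarith [sq_nonneg (z.2 - p.2)]
    have e2 : |z.2 - p.2| < 3 / 2 * h := by
      apply abs_lt_of_sq_lt_sq _ (by positivity); nlinarith [sq_nonneg (z.1 - p.1)]
    rw [abs_lt] at e1 e2
    refine ⟨⟨?_, ?_⟩, ⟨?_, ?_⟩⟩ <;> linarith [e1.1, e1.2, e2.1, e2.2]
  set τ : ℝ := h / (10 * l ^ 2) with hτ
  have hτ0 : 0 < τ := by positivity
  have hgrad : (∫ z in B, |gd u (1, 0) z|) + (∫ z in B, |gd u (0, 1) z|)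
      ≤ 2 * τ * (∫ z in B, ‖u z‖ ^ 2) + (∫ z in B, (‖D1 z‖ ^ 2 + ‖D2 z‖ ^ 2)) / τ := by
    have c1 := (continuous_gd u hu (1, 0)).abs
    have c2 := (continuous_gd u hu (0, 1)).abs
    rw [← integral_add (prod_integrable _ c1 _ _ _ _) (prod_integrable _ c2 _ _ _ _),
      ← integral_const_mul, ← integral_div, ← integral_add
        (prod_integrable _ (by fun_prop) _ _ _ _) (prod_integrable _ (by fun_prop) _ _ _ _)]
    refine integral_mono (prod_integrable _ (c1.add c2) _ _ _ _)
      (prod_integrable _ (by fun_prop) _ _ _ _) ?_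
    intro z
    have e1 := gd_le u (D1 z) _ (1, 0) z τ hτ0 (h1 z)
    have e2 := gd_le u (D2 z) _ (0, 1) z τ hτ0 (h2 z)
    have : 2 * τ * ‖u z‖ ^ 2 + (‖D1 z‖ ^ 2 + ‖D2 z‖ ^ 2) / τ
      = (τ * ‖u z‖ ^ 2 + ‖D1 z‖ ^ 2 / τ) + (τ * ‖u z‖ ^ 2 + ‖D2 z‖ ^ 2 / τ) := by ring
    simp only
    rw [this]
    exact add_le_add e1 e2
  have hT0 : 0 ≤ ∫ z in B, (‖D1 z‖ ^ 2 + ‖D2 z‖ ^ 2) :=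
    setIntegral_nonneg hBm fun z _ => by positivity
  have hG10 : 0 ≤ ∫ z in B, |gd u (1, 0) z| := setIntegral_nonneg hBm fun z _ => abs_nonneg _
  exact main_box_arith _ _ _ _ _ _ _ h l d s τ hh hτ hl hd hs0 hT0 hG10 hpol hq hed hbox hgrad
    (by linarith)

/-! Configuration-space preliminaries -/

theorem cont_abPot_mul (N : ℕ) (Ψ : Config N → ℂ) (hΨ : Admissible N Ψ) (α : ℝ) (j : Fin N)
    (φ : Plane → ℝ) (hφ : Continuous φ) :
    Continuous (fun x => Complex.ofReal (α * φ (abPot N j x)) * Ψ x) := by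
  rw [continuous_iff_continuousAt]
  intro x
  obtain ⟨U, hU, hdU, hz⟩ := hΨ.vanishes
  by_cases hx : x ∈ diagSet N
  · have : (fun x => Complex.ofReal (α * φ (abPot N j x)) * Ψ x) =ᶠ[𝓝 x] fun _ => 0 := by
      filter_upwards [hU.mem_nhds (hdU hx)] with y hy
      rw [hz y hy, mul_zero]
    exact (continuousAt_const).congr this.symm
  · have h1 : ContinuousAt (fun x => abPot N j x) x := by
      unfold abPot
      refine tendsto_finsetSum _ fun k hk => ?_
      have hkj : k ≠ j := Finset.ne_of_mem_erase hk
      have hne : x j - x k ≠ 0 := fun h => hx ⟨j, k, hkj.symm, sub_eq_zero.1 h⟩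
      have hne2 : (x j - x k).1 ^ 2 + (x j - x k).2 ^ 2 ≠ 0 := by
        intro h
        apply hne
        have e1 : (x j - x k).1 = 0 := by nlinarith [sq_nonneg (x j - x k).1, sq_nonneg (x j - x k).2]
        have e2 : (x j - x k).2 = 0 := by nlinarith [sq_nonneg (x j - x k).1, sq_nonneg (x j - x k).2]
        exact Prod.ext e1 e2
      have c1 : Continuous fun y : Config N => (y j - y k).1 := by fun_prop
      have c2 : Continuous fun y : Config N => (y j - y k).2 := by fun_prop
      unfold perpInv
      exact (c2.neg.continuousAt.div (by fun_prop) hne2).prodMk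
        (c1.continuousAt.div (by fun_prop) hne2)
    have h2 : ContinuousAt (fun x => α * φ (abPot N j x)) x :=
      continuousAt_const.mul (hφ.continuousAt.comp h1)
    exact (Complex.continuous_ofReal.continuousAt.comp h2).mul hΨ.smooth.continuous.continuousAt

theorem continuous_pder (N : ℕ) (Ψ : Config N → ℂ) (hΨ : Admissible N Ψ) (j : Fin N) (v : Plane) :
    Continuous (pder N j v Ψ) := by
  have : Continuous (fderiv ℝ Ψ) := hΨ.smooth.continuous_fderiv (by norm_num)
  exact this.clm_apply continuous_const

theorem continuous_DOp1 (N : ℕ) (Ψ : Config N → ℂ) (hΨ : Admissible N Ψ) (α : ℝ) (j : Fin N) :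
    Continuous (fun x => (DOp N α j Ψ x).1) :=
  (continuous_const.mul (continuous_pder N Ψ hΨ j (1, 0))).add
    (cont_abPot_mul N Ψ hΨ α j Prod.fst continuous_fst)

theorem continuous_DOp2 (N : ℕ) (Ψ : Config N → ℂ) (hΨ : Admissible N Ψ) (α : ℝ) (j : Fin N) :
    Continuous (fun x => (DOp N α j Ψ x).2) :=
  (continuous_const.mul (continuous_pder N Ψ hΨ j (0, 1))).add
    (cont_abPot_mul N Ψ hΨ α j Prod.snd continuous_snd)

theorem continuous_DSq (N : ℕ) (Ψ : Config N → ℂ) (hΨ : Admissible N Ψ) (α : ℝ) (j : Fin N) :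
    Continuous (fun x => DSq N α j Ψ x) :=
  ((continuous_DOp1 N Ψ hΨ α j).norm.pow 2).add ((continuous_DOp2 N Ψ hΨ α j).norm.pow 2)

theorem DSq_nonneg (N : ℕ) (Ψ : Config N → ℂ) (α : ℝ) (j : Fin N) (x : Config N) :
    0 ≤ DSq N α j Ψ x := by unfold DSq; positivity

theorem continuous_upd {N : ℕ} (x : Config N) (j : Fin N) :
    Continuous (fun z : Plane => Function.update x j z) :=
  continuous_const.update j continuous_id

theorem slice_contDiff (N : ℕ) (Ψ : Config N → ℂ) (hΨ : Admissible N Ψ) (x : Config N) (j : Fin N) :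
    ContDiff ℝ 1 (fun z : Plane => Ψ (Function.update x j z)) := by
  have h1 : ContDiff ℝ 1 (fun z : Plane => Function.update x j z) := by
    rw [contDiff_pi]
    intro i
    by_cases h : i = j
    · subst h; simp only [Function.update_self]; exact contDiff_id
    · simpa [h] using contDiff_const
  have h2 : ContDiff ℝ 1 Ψ := hΨ.smooth.of_le (by norm_cast)
  exact h2.comp h1

theorem slice_fderiv (N : ℕ) (Ψ : Config N → ℂ) (hΨ : Admissible N Ψ) (x : Config N) (j : Fin N)
    (z v : Plane) : fderiv ℝ (fun z : Plane => Ψ (Function.update x j z)) z v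
      = pder N j v Ψ (Function.update x j z) := by
  have hd : Differentiable ℝ Ψ := hΨ.smooth.differentiable (by norm_num)
  have h1 := (hd (Function.update x j z)).hasFDerivAt.comp z
    (hasFDerivAt_update (𝕜 := ℝ) x (i := j) z)
  have h2 : HasFDerivAt (fun z : Plane => Ψ (Function.update x j z)) _ z := h1
  rw [h2.fderiv]
  simp only [ContinuousLinearMap.comp_apply, pder]
  congr 1
  ext i : 1
  by_cases h : i = j
  · subst h; simp
  · simp [h]

theorem integrableOn_bdd {X : Type*} [MetricSpace X] [ProperSpace X] [MeasurableSpace X]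
    [BorelSpace X] (μ : Measure X) [IsFiniteMeasureOnCompacts μ] (F : X → ℝ) (hF : Continuous F)
    (S : Set X) (hS : Bornology.IsBounded S) : IntegrableOn F S μ :=
  (hF.continuousOn.integrableOn_compact hS.isCompact_closure).mono_set subset_closure

theorem int_pi {N : ℕ} (G : Fin N → Set Plane) (hb : ∀ i, Bornology.IsBounded (G i))
    (F : Config N → ℝ) (hF : Continuous F) : IntegrableOn F (univ.pi G) :=
  integrableOn_bdd _ F hF _ (Bornology.IsBounded.pi hb)

theorem transfer {N : ℕ} (G : Fin N → Set Plane) (hG : ∀ i, MeasurableSet (G i))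
    (hb : ∀ i, Bornology.IsBounded (G i)) (g H : Config N → ℝ) (hg : Continuous g)
    (hH : Continuous H) (hg0 : ∀ x, 0 ≤ g x) (hH0 : ∀ x, 0 ≤ H x) (Z : Set (Config N))
    (hZ : MeasurableSet Z) (j : Fin N)
    (h : ∀ x : Config N, ∫ z in G j ∩ {z | Function.update x j z ∈ Z}, g (Function.update x j z)
      ≤ ∫ z in G j, H (Function.update x j z)) :
    ∫ x in univ.pi G ∩ Z, g x ≤ ∫ x in univ.pi G, H x := by
  have hgi := (int_pi G hb g hg).mono_set (inter_subset_left (t := Z))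
  have hHi := int_pi G hb H hH
  have hpm : MeasurableSet (univ.pi G) := MeasurableSet.univ_pi hG
  have hnn : 0 ≤ ∫ x in univ.pi G, H x := setIntegral_nonneg hpm fun x _ => hH0 x
  rw [← ENNReal.ofReal_le_ofReal_iff hnn,
    ofReal_integral_eq_lintegral_ofReal hgi (Filter.Eventually.of_forall hg0),
    ofReal_integral_eq_lintegral_ofReal hHi (Filter.Eventually.of_forall hH0)]
  have e1 : ∫⁻ x in univ.pi G ∩ Z, ENNReal.ofReal (g x)
      = ∫⁻ x in univ.pi G, Z.indicator (fun x => ENNReal.ofReal (g x)) x := by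
    rw [setLIntegral_indicator hZ, inter_comm]
  rw [e1, volume_pi, Measure.restrict_pi_pi]
  refine lintegral_le_of_lmarginal_le {j} ?_ ?_ ?_
  · exact (ENNReal.measurable_ofReal.comp hg.measurable).indicator hZ
  · exact ENNReal.measurable_ofReal.comp hH.measurable
  · rw [lmarginal_singleton, lmarginal_singleton]
    intro x
    have hm : Measurable (fun z : Plane => Function.update x j z) := (continuous_upd x j).measurable
    have hZ' : MeasurableSet {z | Function.update x j z ∈ Z} := hm hZ
    have e2 : ∫⁻ z in G j, Z.indicator (fun x => ENNReal.ofReal (g x)) (Function.update x j z)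
      = ∫⁻ z in G j ∩ {z | Function.update x j z ∈ Z}, ENNReal.ofReal (g (Function.update x j z)) := by
      rw [inter_comm, ← setLIntegral_indicator hZ']
      rfl
    simp only
    rw [e2]
    have hgu : Continuous fun z => g (Function.update x j z) := hg.comp (continuous_upd x j)
    have hHu : Continuous fun z => H (Function.update x j z) := hH.comp (continuous_upd x j)
    have i1 := (integrableOn_bdd volume _ hgu _ (hb j)).mono_set
      (inter_subset_left (t := {z | Function.update x j z ∈ Z}))
    have i2 := integrableOn_bdd volume _ hHu _ (hb j)
    rw [← ofReal_integral_eq_lintegral_ofReal i1 (Filter.Eventually.of_forall fun z => hg0 _),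
      ← ofReal_integral_eq_lintegral_ofReal i2 (Filter.Eventually.of_forall fun z => hH0 _)]
    exact ENNReal.ofReal_le_ofReal (h x)

/-- Half-open square box. -/
def bx (a b l : ℝ) : Set Plane := Ioc a (a + l) ×ˢ Ioc b (b + l)

theorem bx_meas (a b l : ℝ) : MeasurableSet (bx a b l) := measurableSet_Ioc.prod measurableSet_Ioc

theorem bx_bdd (a b l : ℝ) : Bornology.IsBounded (bx a b l) :=
  (Metric.isBounded_Ioc _ _).prod (Metric.isBounded_Ioc _ _)

theorem abPot_update (N : ℕ) (x : Config N) (j : Fin N) (z : Plane) :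
    abPot N j (Function.update x j z) = ∑ k ∈ Finset.univ.erase j, perpInv (z - x k) := by
  unfold abPot
  refine Finset.sum_congr rfl fun k hk => ?_
  rw [Function.update_self, Function.update_of_ne (Finset.ne_of_mem_erase hk)]

/-- Good configurations for the pair `(j,k)`. -/
def goodSet (N : ℕ) (j k : Fin N) (a b l d : ℝ) : Set (Config N) :=
  {x | (a + 2 * d * l < (x k).1 ∧ (x k).1 + 2 * d * l < a + l
    ∧ b + 2 * d * l < (x k).2 ∧ (x k).2 + 2 * d * l < b + l) ∧
    ∀ i, i ≠ j → i ≠ k →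
      (3 / 2 * (d * l)) ^ 2 ≤ ((x i).1 - (x k).1) ^ 2 + ((x i).2 - (x k).2) ^ 2}

theorem goodSet_meas (N : ℕ) (j k : Fin N) (a b l d : ℝ) :
    MeasurableSet (goodSet N j k a b l d) := by
  have c : ∀ i : Fin N, Continuous fun x : Config N => (x i).1 := fun i => by fun_prop
  have c' : ∀ i : Fin N, Continuous fun x : Config N => (x i).2 := fun i => by fun_prop
  have hc := c k
  have hc' := c' k
  have m1 : MeasurableSet {x : Config N | a + 2 * d * l < (x k).1} :=
    measurableSet_lt (by fun_prop) (by fun_prop)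
  have m2 : MeasurableSet {x : Config N | (x k).1 + 2 * d * l < a + l} :=
    measurableSet_lt (by fun_prop) (by fun_prop)
  have m3 : MeasurableSet {x : Config N | b + 2 * d * l < (x k).2} :=
    measurableSet_lt (by fun_prop) (by fun_prop)
  have m4 : MeasurableSet {x : Config N | (x k).2 + 2 * d * l < b + l} :=
    measurableSet_lt (by fun_prop) (by fun_prop)
  refine (m1.inter (m2.inter (m3.inter m4))).inter ?_
  · have : {x : Config N | ∀ i, i ≠ j → i ≠ k →
      (3 / 2 * (d * l)) ^ 2 ≤ ((x i).1 - (x k).1) ^ 2 + ((x i).2 - (x k).2) ^ 2}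
      = ⋂ i : Fin N, ⋂ _ : i ≠ j, ⋂ _ : i ≠ k, {x : Config N |
      (3 / 2 * (d * l)) ^ 2 ≤ ((x i).1 - (x k).1) ^ 2 + ((x i).2 - (x k).2) ^ 2} := by
      ext x; simp
    change MeasurableSet {x : Config N | ∀ i, i ≠ j → i ≠ k →
      (3 / 2 * (d * l)) ^ 2 ≤ ((x i).1 - (x k).1) ^ 2 + ((x i).2 - (x k).2) ^ 2}
    rw [this]
    refine MeasurableSet.iInter fun i => MeasurableSet.iInter fun _ => MeasurableSet.iInter fun _ => ?_
    exact measurableSet_le (by fun_prop) (by fun_prop)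

theorem goodSet_update (N : ℕ) (j k : Fin N) (hjk : j ≠ k) (a b l d : ℝ) (x : Config N) (z : Plane) :
    Function.update x j z ∈ goodSet N j k a b l d ↔ x ∈ goodSet N j k a b l d := by
  unfold goodSet
  simp only [mem_ofPred_eq, Function.update_of_ne hjk.symm]
  refine and_congr_right fun _ => forall_congr' fun i => ?_
  refine forall_congr' fun hi => ?_
  rw [Function.update_of_ne hi]

theorem circ_total (N : ℕ) (x : Config N) (j k : Fin N) (hjk : j ≠ k) (α R r : ℝ) (hr : r ∈ Ioo 0 R)
    (hx : ∀ i, i ≠ j → i ≠ k → R ^ 2 ≤ ((x i).1 - (x k).1) ^ 2 + ((x i).2 - (x k).2) ^ 2) :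
    Continuous (fun θ => α • abPot N j (Function.update x j (ppt (x k) r θ))) ∧
    ∫ θ in (-π)..π, r * (-Real.sin θ * (α • abPot N j (Function.update x j (ppt (x k) r θ))).1
      + Real.cos θ * (α • abPot N j (Function.update x j (ppt (x k) r θ))).2) = 2 * π * α := by
  have hr0 := hr.1
  simp_rw [abPot_update]
  have hcont : ∀ i ∈ Finset.univ.erase j,
      Continuous (fun θ => perpInv (ppt (x k) r θ - x i)) := by
    intro i hi
    have hij := Finset.ne_of_mem_erase hi
    refine continuous_perpInv_comp _ ((continuous_ppt2 _ _).sub continuous_const) fun θ => ?_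
    by_cases hik : i = k
    · subst hik
      simp only [ppt, Prod.fst_sub, Prod.snd_sub, add_sub_cancel_left]
      have : (r * Real.cos θ) ^ 2 + (r * Real.sin θ) ^ 2 = r ^ 2 := by
        nlinarith [Real.sin_sq_add_cos_sq θ]
      rw [this]; positivity
    · refine ppt_sub_ne _ _ _ ?_ θ
      have := hx i hij hik
      nlinarith [hr.1, hr.2]
  refine ⟨(continuous_finsetSum _ hcont).const_smul α, ?_⟩
  have e : ∀ θ, r * (-Real.sin θ * (α • ∑ i ∈ Finset.univ.erase j, perpInv (ppt (x k) r θ - x i)).1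
      + Real.cos θ * (α • ∑ i ∈ Finset.univ.erase j, perpInv (ppt (x k) r θ - x i)).2)
      = ∑ i ∈ Finset.univ.erase j, α * (r * (-Real.sin θ * (perpInv (ppt (x k) r θ - x i)).1
      + Real.cos θ * (perpInv (ppt (x k) r θ - x i)).2)) := by
    intro θ
    simp only [Prod.smul_fst, Prod.smul_snd, Prod.fst_sum, Prod.snd_sum, smul_eq_mul]
    simp only [Finset.mul_sum, ← Finset.sum_add_distrib]
    refine Finset.sum_congr rfl fun i _ => ?_
    ring
  simp_rw [e]
  rw [intervalIntegral.integral_finsetSum]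
  · have hk : k ∈ Finset.univ.erase j := by simp [hjk.symm]
    rw [Finset.sum_eq_single_of_mem k hk]
    · rw [intervalIntegral.integral_const_mul, circ_in _ _ hr0]; ring
    · intro i hi hik
      rw [intervalIntegral.integral_const_mul, circ_out _ _ _ hr0, mul_zero]
      have := hx i (Finset.ne_of_mem_erase hi) hik
      nlinarith [hr.1, hr.2]
  · intro i hi
    have h1 := hcont i hi
    have h3 : Continuous fun θ => (perpInv (ppt (x k) r θ - x i)).1 := continuous_fst.comp h1
    have h4 : Continuous fun θ => (perpInv (ppt (x k) r θ - x i)).2 := continuous_snd.comp h1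
    exact Continuous.intervalIntegrable (by fun_prop) _ _

theorem lemmaA (N : ℕ) (Ψ : Config N → ℂ) (hΨ : Admissible N Ψ) (α s : ℝ)
    (hs : s = Real.sin (π * α) / π) (hs0 : 0 < s) (G : Fin N → Set Plane)
    (hG : ∀ i, MeasurableSet (G i)) (hb : ∀ i, Bornology.IsBounded (G i)) (j k : Fin N)
    (hjk : j ≠ k) (a b l d : ℝ) (hl : 0 < l) (hd : 0 < d) (hGj : G j = bx a b l) :
    ∫ x in univ.pi G ∩ goodSet N j k a b l d, ‖Ψ x‖ ^ 2
      ≤ l ^ 2 * (5 / (16 * s) + 6 / d ^ 2) * ∫ x in univ.pi G, DSq N α j Ψ x := by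
  rw [← integral_const_mul]
  have hΨc : Continuous Ψ := hΨ.smooth.continuous
  refine transfer G hG hb (fun x => ‖Ψ x‖ ^ 2) _ (by fun_prop)
    ((continuous_DSq N Ψ hΨ α j).const_mul _) (fun x => by positivity)
    (fun x => mul_nonneg (by positivity) (DSq_nonneg _ _ _ _ _)) _ (goodSet_meas N j k a b l d) j ?_
  intro x
  simp only [goodSet_update N j k hjk]
  by_cases hx : x ∈ goodSet N j k a b l d
  · simp only [hx, ofPred_true, inter_univ]
    rw [integral_const_mul, hGj]
    have hx1 := hx.1
    refine main_box (fun z => Ψ (Function.update x j z)) (slice_contDiff N Ψ hΨ x j)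
      (fun z => (DOp N α j Ψ (Function.update x j z)).1)
      (fun z => (DOp N α j Ψ (Function.update x j z)).2)
      ((continuous_DOp1 N Ψ hΨ α j).comp (continuous_upd x j))
      ((continuous_DOp2 N Ψ hΨ α j).comp (continuous_upd x j))
      (fun z => α • abPot N j (Function.update x j z)) ?_ ?_ a b l d hl hd (x k)
      hx1.1 hx1.2.1 hx1.2.2.1 hx1.2.2.2 ?_ α s hs hs0 ?_ ?_
    · intro z
      rw [slice_fderiv N Ψ hΨ]; simp [DOp]
    · intro z
      rw [slice_fderiv N Ψ hΨ]; simp [DOp]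
    · obtain ⟨U, hU, hdU, hz⟩ := hΨ.vanishes
      refine hz _ (hdU ⟨j, k, hjk, ?_⟩)
      rw [Function.update_self, Function.update_of_ne hjk.symm]
    · intro r hr
      exact (circ_total N x j k hjk α _ r hr hx.2).1
    · intro r hr
      exact (circ_total N x j k hjk α _ r hr hx.2).2
  · simp only [hx, ofPred_false, inter_empty, setIntegral_empty]
    exact setIntegral_nonneg (hG j) fun z _ => mul_nonneg (by positivity) (DSq_nonneg _ _ _ _ _)

theorem bx_int (a b l : ℝ) (F : Plane → ℝ) (hF : Continuous F) : IntegrableOn F (bx a b l) :=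
  prod_integrable F hF _ _ _ _

theorem slab_bd1 (N : ℕ) (Ψ : Config N → ℂ) (hΨ : Admissible N Ψ) (α : ℝ) (G : Fin N → Set Plane)
    (hG : ∀ i, MeasurableSet (G i)) (hb : ∀ i, Bornology.IsBounded (G i)) (k : Fin N)
    (a b l ρ : ℝ) (hl : 0 < l) (hρ : 0 ≤ ρ) (hGk : G k = bx a b l) (c : Config N → ℝ)
    (hc : Continuous c) (hck : ∀ x z, c (Function.update x k z) = c x) :
    ∫ x in univ.pi G ∩ {x | |(x k).1 - c x| ≤ ρ}, ‖Ψ x‖ ^ 2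
      ≤ (2 * ρ / l) * (2 * (∫ x in univ.pi G, ‖Ψ x‖ ^ 2) + l ^ 2 * ∫ x in univ.pi G, DSq N α k Ψ x) := by
  have hΨc : Continuous Ψ := hΨ.smooth.continuous
  have hDc := continuous_DSq N Ψ hΨ α k
  have hgc : Continuous fun x => ‖Ψ x‖ ^ 2 := by fun_prop
  rw [← integral_const_mul, ← integral_const_mul, ← integral_add
    ((int_pi G hb _ hgc).const_mul _) ((int_pi G hb _ hDc).const_mul _), ← integral_const_mul]
  have hD0 := DSq_nonneg N Ψ α k
  refine transfer G hG hb (fun x => ‖Ψ x‖ ^ 2)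
    (fun x => 2 * ρ / l * (2 * ‖Ψ x‖ ^ 2 + l ^ 2 * DSq N α k Ψ x)) (by fun_prop)
    (by fun_prop) (fun x => by positivity)
    (fun x => by have := hD0 x; positivity) _
    (measurableSet_le (by fun_prop) (by fun_prop)) k ?_
  intro x
  simp only [mem_ofPred_eq, Function.update_self, hck]
  set u : Plane → ℂ := fun z => Ψ (Function.update x k z) with hu
  have huC : ContDiff ℝ 1 u := slice_contDiff N Ψ hΨ x k
  have huc : Continuous u := huC.continuous
  have hDu : Continuous fun z => DSq N α k Ψ (Function.update x k z) := hDc.comp (continuous_upd x k)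
  have hs := slab1 (fun z => ‖u z‖ ^ 2) (gd u (1, 0)) (by fun_prop) (continuous_gd u huC _)
    (fun z => by positivity) (hasDerivAt_g1 u huC) a b l (c x) ρ hl hρ
  rw [hGk]
  have hle : l * (∫ z in bx a b l, |gd u (1, 0) z|) ≤
      (∫ z in bx a b l, ‖u z‖ ^ 2) + l ^ 2 * ∫ z in bx a b l, DSq N α k Ψ (Function.update x k z) := by
    rw [← integral_const_mul, ← integral_const_mul, ← integral_add
      (bx_int _ _ _ _ (by fun_prop)) (bx_int _ _ _ _ (by fun_prop))]
    have c1 := (continuous_gd u huC (1, 0)).abs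
    refine integral_mono (bx_int _ _ _ _ (by fun_prop))
      (bx_int _ _ _ _ (by fun_prop)) ?_
    intro z
    have e1 := gd_le u (DOp N α k Ψ (Function.update x k z)).1 (α * (abPot N k (Function.update x k z)).1)
      (1, 0) z (1 / l) (by positivity) (by rw [hu, slice_fderiv N Ψ hΨ]; rfl)
    have e2 := mul_le_mul_of_nonneg_left e1 hl.le
    have e3 : l * (1 / l * ‖u z‖ ^ 2 + ‖(DOp N α k Ψ (Function.update x k z)).1‖ ^ 2 / (1 / l))
      = ‖u z‖ ^ 2 + l ^ 2 * ‖(DOp N α k Ψ (Function.update x k z)).1‖ ^ 2 := by field_simp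
    simp only [DSq]
    rw [e3] at e2
    have : 0 ≤ l ^ 2 * ‖(DOp N α k Ψ (Function.update x k z)).2‖ ^ 2 := by positivity
    linarith
  rw [integral_const_mul]
  change _ ≤ 2 * ρ / l * ∫ z in bx a b l, (2 * ‖u z‖ ^ 2 + l ^ 2 * DSq N α k Ψ (Function.update x k z))
  rw [integral_add
    ((bx_int _ _ _ _ (by fun_prop)))
    ((bx_int _ _ _ _ (by fun_prop))), integral_const_mul, integral_const_mul]
  rw [div_mul_eq_mul_div, le_div_iff₀ hl]
  change l * (∫ z in bx a b l ∩ {z | |z.1 - c x| ≤ ρ}, ‖u z‖ ^ 2) ≤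
      2 * ρ * ((∫ z in bx a b l, ‖u z‖ ^ 2) + l * ∫ z in bx a b l, |gd u (1, 0) z|) at hs
  have := mul_le_mul_of_nonneg_left hle (by positivity : 0 ≤ 2 * ρ)
  linarith

theorem slab_bd2 (N : ℕ) (Ψ : Config N → ℂ) (hΨ : Admissible N Ψ) (α : ℝ) (G : Fin N → Set Plane)
    (hG : ∀ i, MeasurableSet (G i)) (hb : ∀ i, Bornology.IsBounded (G i)) (k : Fin N)
    (a b l ρ : ℝ) (hl : 0 < l) (hρ : 0 ≤ ρ) (hGk : G k = bx a b l) (c : Config N → ℝ)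
    (hc : Continuous c) (hck : ∀ x z, c (Function.update x k z) = c x) :
    ∫ x in univ.pi G ∩ {x | |(x k).2 - c x| ≤ ρ}, ‖Ψ x‖ ^ 2
      ≤ (2 * ρ / l) * (2 * (∫ x in univ.pi G, ‖Ψ x‖ ^ 2) + l ^ 2 * ∫ x in univ.pi G, DSq N α k Ψ x) := by
  have hΨc : Continuous Ψ := hΨ.smooth.continuous
  have hDc := continuous_DSq N Ψ hΨ α k
  have hgc : Continuous fun x => ‖Ψ x‖ ^ 2 := by fun_prop
  rw [← integral_const_mul, ← integral_const_mul, ← integral_add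
    ((int_pi G hb _ hgc).const_mul _) ((int_pi G hb _ hDc).const_mul _), ← integral_const_mul]
  have hD0 := DSq_nonneg N Ψ α k
  refine transfer G hG hb (fun x => ‖Ψ x‖ ^ 2)
    (fun x => 2 * ρ / l * (2 * ‖Ψ x‖ ^ 2 + l ^ 2 * DSq N α k Ψ x)) (by fun_prop)
    (by fun_prop) (fun x => by positivity)
    (fun x => by have := hD0 x; positivity) _
    (measurableSet_le (by fun_prop) (by fun_prop)) k ?_
  intro x
  simp only [mem_ofPred_eq, Function.update_self, hck]
  set u : Plane → ℂ := fun z => Ψ (Function.update x k z) with hu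
  have huC : ContDiff ℝ 1 u := slice_contDiff N Ψ hΨ x k
  have huc : Continuous u := huC.continuous
  have hDu : Continuous fun z => DSq N α k Ψ (Function.update x k z) := hDc.comp (continuous_upd x k)
  have hs := slab2 (fun z => ‖u z‖ ^ 2) (gd u (0, 1)) (by fun_prop) (continuous_gd u huC _)
    (fun z => by positivity) (hasDerivAt_g2 u huC) a b l (c x) ρ hl hρ
  rw [hGk]
  have hle : l * (∫ z in bx a b l, |gd u (0, 1) z|) ≤
      (∫ z in bx a b l, ‖u z‖ ^ 2) + l ^ 2 * ∫ z in bx a b l, DSq N α k Ψ (Function.update x k z) := by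
    rw [← integral_const_mul, ← integral_const_mul, ← integral_add
      (bx_int _ _ _ _ (by fun_prop)) (bx_int _ _ _ _ (by fun_prop))]
    have c1 := (continuous_gd u huC (0, 1)).abs
    refine integral_mono (bx_int _ _ _ _ (by fun_prop))
      (bx_int _ _ _ _ (by fun_prop)) ?_
    intro z
    have e1 := gd_le u (DOp N α k Ψ (Function.update x k z)).2 (α * (abPot N k (Function.update x k z)).2)
      (0, 1) z (1 / l) (by positivity) (by rw [hu, slice_fderiv N Ψ hΨ]; rfl)
    have e2 := mul_le_mul_of_nonneg_left e1 hl.le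
    have e3 : l * (1 / l * ‖u z‖ ^ 2 + ‖(DOp N α k Ψ (Function.update x k z)).2‖ ^ 2 / (1 / l))
      = ‖u z‖ ^ 2 + l ^ 2 * ‖(DOp N α k Ψ (Function.update x k z)).2‖ ^ 2 := by field_simp
    simp only [DSq]
    rw [e3] at e2
    have : 0 ≤ l ^ 2 * ‖(DOp N α k Ψ (Function.update x k z)).1‖ ^ 2 := by positivity
    linarith
  rw [integral_const_mul]
  change _ ≤ 2 * ρ / l * ∫ z in bx a b l, (2 * ‖u z‖ ^ 2 + l ^ 2 * DSq N α k Ψ (Function.update x k z))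
  rw [integral_add
    ((bx_int _ _ _ _ (by fun_prop)))
    ((bx_int _ _ _ _ (by fun_prop))), integral_const_mul, integral_const_mul]
  rw [div_mul_eq_mul_div, le_div_iff₀ hl]
  change l * (∫ z in bx a b l ∩ {z | |z.2 - c x| ≤ ρ}, ‖u z‖ ^ 2) ≤
      2 * ρ * ((∫ z in bx a b l, ‖u z‖ ^ 2) + l * ∫ z in bx a b l, |gd u (0, 1) z|) at hs
  have := mul_le_mul_of_nonneg_left hle (by positivity : 0 ≤ 2 * ρ)
  linarith

theorem union_bound {X ι : Type*} [MeasurableSpace X] (μ : Measure X) (P : Set X)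
    (hP : MeasurableSet P) (g : X → ℝ) (hg : IntegrableOn g P μ) (hg0 : ∀ x, 0 ≤ g x)
    (F : Finset ι) (Z : ι → Set X) (hZ : ∀ t ∈ F, MeasurableSet (Z t))
    (hcov : ∀ x ∈ P, ∃ t ∈ F, x ∈ Z t) :
    ∫ x in P, g x ∂μ ≤ ∑ t ∈ F, ∫ x in P ∩ Z t, g x ∂μ := by
  have h1 : ∀ t ∈ F, ∫ x in P ∩ Z t, g x ∂μ = ∫ x in P, (Z t).indicator g x ∂μ := by
    intro t ht
    rw [setIntegral_indicator (hZ t ht)]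
  rw [Finset.sum_congr rfl h1, ← integral_finsetSum]
  · refine setIntegral_mono_on hg ?_ hP ?_
    · exact integrable_finsetSum _ fun t ht => hg.indicator (hZ t ht)
    · intro x hx
      obtain ⟨t, ht, hxt⟩ := hcov x hx
      have : g x = (Z t).indicator g x := by rw [indicator_of_mem hxt]
      rw [this]
      exact Finset.single_le_sum (f := fun t => (Z t).indicator g x)
        (fun t _ => indicator_nonneg (fun x _ => hg0 x) x) ht
  · intro t ht; exact hg.indicator (hZ t ht)

theorem pair_bd (N : ℕ) (Ψ : Config N → ℂ) (hΨ : Admissible N Ψ) (α s : ℝ)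
    (hs : s = Real.sin (π * α) / π) (hs0 : 0 < s) (G : Fin N → Set Plane)
    (hG : ∀ i, MeasurableSet (G i)) (hb : ∀ i, Bornology.IsBounded (G i))
    (a b l d : ℝ) (hl : 0 < l) (hd : 0 < d) (S : Finset (Fin N))
    (hS : ∀ i ∈ S, G i = bx a b l) (hS' : ∀ i, i ∉ S → Disjoint (G i) (bx a b l))
    (j k : Fin N) (hj : j ∈ S) (hk : k ∈ S) (hjk : j ≠ k) :
    ∫ x in univ.pi G, ‖Ψ x‖ ^ 2
      ≤ l ^ 2 * (5 / (16 * s) + 6 / d ^ 2) * (∫ x in univ.pi G, DSq N α j Ψ x)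
        + ((S.card : ℝ) + 2) * ((4 * d) * (2 * (∫ x in univ.pi G, ‖Ψ x‖ ^ 2)
          + l ^ 2 * ∫ x in univ.pi G, DSq N α k Ψ x)) := by
  have hΨc : Continuous Ψ := hΨ.smooth.continuous
  have hgc : Continuous fun x => ‖Ψ x‖ ^ 2 := by fun_prop
  have hA := lemmaA N Ψ hΨ α s hs hs0 G hG hb j k hjk a b l d hl hd (hS j hj)
  have hρ : (0 : ℝ) ≤ 2 * d * l := by positivity
  have hρl : 2 * (2 * d * l) / l = 4 * d := by field_simp; ring
  have B1 := fun c hc hck => slab_bd1 N Ψ hΨ α G hG hb k a b l (2 * d * l) hl hρ (hS k hk) c hc hck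
  have B2 := fun c hc hck => slab_bd2 N Ψ hΨ α G hG hb k a b l (2 * d * l) hl hρ (hS k hk) c hc hck
  rw [hρl] at B1 B2
  set K := (4 * d) * (2 * (∫ x in univ.pi G, ‖Ψ x‖ ^ 2)
          + l ^ 2 * ∫ x in univ.pi G, DSq N α k Ψ x) with hK
  have hU := union_bound volume (univ.pi G) (MeasurableSet.univ_pi hG) (fun x => ‖Ψ x‖ ^ 2)
    (int_pi G hb _ hgc) (fun x => by positivity)
    ((Finset.univ : Finset (Fin 5)).disjSum ((S.erase j).erase k))
    (Sum.elim ![goodSet N j k a b l d, {x | |(x k).1 - a| ≤ 2 * d * l},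
      {x | |(x k).1 - (a + l)| ≤ 2 * d * l}, {x | |(x k).2 - b| ≤ 2 * d * l},
      {x | |(x k).2 - (b + l)| ≤ 2 * d * l}] (fun i => {x | |(x k).1 - (x i).1| ≤ 2 * d * l}))
    ?_ ?_
  · refine hU.trans ?_
    rw [Finset.sum_disjSum, Fin.sum_univ_five]
    simp only [Sum.elim_inl, Sum.elim_inr, Matrix.cons_val_zero, Matrix.cons_val_one, Matrix.cons_val]
    have b1 := B1 (fun _ => a) continuous_const (fun _ _ => rfl)
    have b2 := B1 (fun _ => a + l) continuous_const (fun _ _ => rfl)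
    have b3 := B2 (fun _ => b) continuous_const (fun _ _ => rfl)
    have b4 := B2 (fun _ => b + l) continuous_const (fun _ _ => rfl)
    have b5 : ∑ i ∈ (S.erase j).erase k,
        ∫ x in univ.pi G ∩ {x : Config N | |(x k).1 - (x i).1| ≤ 2 * d * l}, ‖Ψ x‖ ^ 2
        ≤ ((S.erase j).erase k).card • K := by
      refine Finset.sum_le_card_nsmul _ _ _ fun i hi => ?_
      refine B1 (fun x => (x i).1) (by fun_prop) fun x z => ?_
      rw [Function.update_of_ne (Finset.ne_of_mem_erase hi)]
    have hcard : (((S.erase j).erase k).card : ℝ) = (S.card : ℝ) - 2 := by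
      have e1 := Finset.card_erase_add_one hj
      have e2 := Finset.card_erase_add_one (Finset.mem_erase.2 ⟨hjk.symm, hk⟩)
      have : ((S.erase j).erase k).card + 1 + 1 = S.card := by omega
      rw [← this]; push_cast; ring
    rw [nsmul_eq_mul, hcard] at b5
    linarith
  · rintro t -
    rcases t with t | i
    · fin_cases t
      · exact goodSet_meas N j k a b l d
      · exact measurableSet_le (by fun_prop) (by fun_prop)
      · exact measurableSet_le (by fun_prop) (by fun_prop)
      · exact measurableSet_le (by fun_prop) (by fun_prop)
      · exact measurableSet_le (by fun_prop) (by fun_prop)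
    · exact measurableSet_le (by fun_prop) (by fun_prop)
  · intro x hx
    by_contra! hno
    have n0 := hno (Sum.inl 0) (by simp)
    have n1 := hno (Sum.inl 1) (by simp)
    have n2 := hno (Sum.inl 2) (by simp)
    have n3 := hno (Sum.inl 3) (by simp)
    have n4 := hno (Sum.inl 4) (by simp)
    simp only [Sum.elim_inl, Matrix.cons_val_zero, Matrix.cons_val_one, Matrix.cons_val,
      mem_ofPred_eq, not_le] at n0 n1 n2 n3 n4
    have hxk : x k ∈ bx a b l := hS k hk ▸ hx k (mem_univ k)
    obtain ⟨⟨p1, p2⟩, ⟨p3, p4⟩⟩ := hxk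
    rw [abs_of_pos (by linarith)] at n1 n3
    rw [abs_of_nonpos (by linarith)] at n2 n4
    apply n0
    refine ⟨⟨by linarith, by linarith, by linarith, by linarith⟩, ?_⟩
    intro i hij hik
    have hdl : 0 < d * l := by positivity
    by_cases hi : i ∈ S
    · have n5 := hno (Sum.inr i) (by simp [hi, hij, hik])
      simp only [Sum.elim_inr, mem_ofPred_eq, not_le] at n5
      have : (2 * d * l) ^ 2 < ((x k).1 - (x i).1) ^ 2 := by
        rw [← sq_abs ((x k).1 - (x i).1)]; exact pow_lt_pow_left₀ n5 hρ (by norm_num)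
      nlinarith [sq_nonneg ((x i).2 - (x k).2)]
    · by_contra! hlt
      have e1 : |(x i).1 - (x k).1| < 3 / 2 * (d * l) := by
        apply abs_lt_of_sq_lt_sq _ (by positivity); nlinarith [sq_nonneg ((x i).2 - (x k).2)]
      have e2 : |(x i).2 - (x k).2| < 3 / 2 * (d * l) := by
        apply abs_lt_of_sq_lt_sq _ (by positivity); nlinarith [sq_nonneg ((x i).1 - (x k).1)]
      rw [abs_lt] at e1 e2
      refine disjoint_left.1 (hS' i hi) (hx i (mem_univ i)) ⟨⟨?_, ?_⟩, ⟨?_, ?_⟩⟩ <;>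
        linarith [e1.1, e1.2, e2.1, e2.2]

/-- Lower bound with constant `c` for `n` particles in a box. -/
def Bd (N : ℕ) (α : ℝ) (Ψ : Config N → ℂ) (n : ℕ) (c : ℝ) : Prop :=
  ∀ (a b l : ℝ), 0 < l → ∀ (S : Finset (Fin N)), S.card = n → ∀ G : Fin N → Set Plane,
    (∀ i, MeasurableSet (G i)) → (∀ i, Bornology.IsBounded (G i)) →
    (∀ i ∈ S, G i = bx a b l) → (∀ i, i ∉ S → Disjoint (G i) (bx a b l)) →
    c * ∫ x in univ.pi G, ‖Ψ x‖ ^ 2 ≤ l ^ 2 * ∑ j ∈ S, ∫ x in univ.pi G, DSq N α j Ψ x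

theorem int_DSq_nonneg (N : ℕ) (Ψ : Config N → ℂ) (α : ℝ) (j : Fin N) (G : Fin N → Set Plane)
    (hG : ∀ i, MeasurableSet (G i)) : 0 ≤ ∫ x in univ.pi G, DSq N α j Ψ x :=
  setIntegral_nonneg (MeasurableSet.univ_pi hG) fun x _ => DSq_nonneg N Ψ α j x

theorem local_bd (N : ℕ) (Ψ : Config N → ℂ) (hΨ : Admissible N Ψ) (α s : ℝ)
    (hs : s = Real.sin (π * α) / π) (hs0 : 0 < s) (d : ℝ) (hd : 0 < d) (n : ℕ) (hn : 2 ≤ n) :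
    Bd N α Ψ n ((n : ℝ) * (1 - 8 * ((n : ℝ) + 2) * d) /
      (5 / (16 * s) + 6 / d ^ 2 + 4 * ((n : ℝ) + 2) * d)) := by
  intro a b l hl S hcard G hG hb hS hS'
  set I := ∫ x in univ.pi G, ‖Ψ x‖ ^ 2 with hI
  set t : Fin N → ℝ := fun j => ∫ x in univ.pi G, DSq N α j Ψ x with ht
  set Λ := 5 / (16 * s) + 6 / d ^ 2 with hΛ
  have hΛ0 : 0 < Λ := by positivity
  have hn2 : (2 : ℝ) ≤ n := by exact_mod_cast hn
  have h1 : ∀ j ∈ S, ((n : ℝ) - 1) * I ≤ ((n : ℝ) - 1) * (l ^ 2 * Λ * t j)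
      + (((n : ℝ) + 2) * (4 * d)) * (2 * ((n : ℝ) - 1) * I + l ^ 2 * (∑ k ∈ S, t k - t j)) := by
    intro j hj
    have hce : ((S.erase j).card : ℝ) = (n : ℝ) - 1 := by
      have := Finset.card_erase_add_one hj
      rw [hcard] at this
      rw [← this]; push_cast; ring
    have h2 : ∑ k ∈ S.erase j, I ≤ ∑ k ∈ S.erase j, (l ^ 2 * Λ * t j
        + ((n : ℝ) + 2) * ((4 * d) * (2 * I + l ^ 2 * t k))) := by
      refine Finset.sum_le_sum fun k hk => ?_
      have := pair_bd N Ψ hΨ α s hs hs0 G hG hb a b l d hl hd S hS hS' j k hj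
        (Finset.mem_of_mem_erase hk) (Finset.ne_of_mem_erase hk).symm
      rw [hcard] at this
      exact this
    have h3 : ∑ k ∈ S.erase j, t k = ∑ k ∈ S, t k - t j := by
      rw [← Finset.sum_erase_add S t hj]; ring
    rw [Finset.sum_const, nsmul_eq_mul, hce, Finset.sum_add_distrib, Finset.sum_const, nsmul_eq_mul,
      hce, ← Finset.mul_sum, ← Finset.mul_sum, Finset.sum_add_distrib, Finset.sum_const, nsmul_eq_mul,
      hce, ← Finset.mul_sum, h3] at h2
    linarith
  have h2 := Finset.sum_le_sum h1
  have hT0 : 0 ≤ ∑ k ∈ S, t k := Finset.sum_nonneg fun j _ => int_DSq_nonneg N Ψ α j G hG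
  set T := ∑ k ∈ S, t k with hT
  have h3 : (n : ℝ) * (((n : ℝ) - 1) * I) ≤ ((n : ℝ) - 1) * (l ^ 2 * Λ * T)
      + (((n : ℝ) + 2) * (4 * d)) * (2 * ((n : ℝ) - 1) * (n * I) + l ^ 2 * (n * T - T)) := by
    rw [Finset.sum_const, nsmul_eq_mul, hcard, Finset.sum_add_distrib, ← Finset.mul_sum,
      ← Finset.mul_sum, ← Finset.mul_sum, Finset.sum_add_distrib, Finset.sum_const, nsmul_eq_mul,
      hcard, ← Finset.mul_sum, Finset.sum_sub_distrib, Finset.sum_const, nsmul_eq_mul, hcard] at h2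
    linarith
  have h4 : ((n : ℝ) - 1) * ((n : ℝ) * (1 - 8 * ((n : ℝ) + 2) * d) * I) ≤
      ((n : ℝ) - 1) * (l ^ 2 * T * (Λ + 4 * ((n : ℝ) + 2) * d)) := by linarith
  have h5 := le_of_mul_le_mul_left h4 (by linarith)
  rw [div_mul_eq_mul_div, div_le_iff₀ (by positivity)]
  exact h5

open Classical in
/-- Pieces of the region according to which particles of `S` lie in `Q`. -/
def piece {N : ℕ} (G : Fin N → Set Plane) (S S' : Finset (Fin N)) (Q : Set Plane) :
    Fin N → Set Plane :=
  fun i => if i ∈ S then (if i ∈ S' then G i ∩ Q else G i \ Q) else G i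

open Classical in
/-- particles of `S` located in `Q`. -/
def occ {N : ℕ} (S : Finset (Fin N)) (Q : Set Plane) (x : Config N) : Finset (Fin N) :=
  S.filter fun i => x i ∈ Q

theorem mem_piece {N : ℕ} (G : Fin N → Set Plane) (S S' : Finset (Fin N)) (hS : S' ⊆ S)
    (Q : Set Plane) (x : Config N) :
    x ∈ univ.pi (piece G S S' Q) ↔ x ∈ univ.pi G ∧ occ S Q x = S' := by
  classical
  simp only [mem_univ_pi, occ, piece]
  constructor
  · intro h
    refine ⟨fun i => ?_, ?_⟩
    · have := h i
      split_ifs at this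
      · exact this.1
      · exact this.1
      · exact this
    · ext i
      have := h i
      simp only [Finset.mem_filter]
      split_ifs at this with h1 h2
      · exact ⟨fun _ => h2, fun _ => ⟨h1, this.2⟩⟩
      · exact ⟨fun h => absurd h.2 this.2, fun h => absurd h h2⟩
      · exact ⟨fun h => absurd h.1 h1, fun h => absurd (hS h) h1⟩
  · rintro ⟨h1, h2⟩ i
    have h3 : i ∈ S' ↔ i ∈ S ∧ x i ∈ Q := by rw [← h2]; simp
    split_ifs with h4 h5
    · exact ⟨h1 i, (h3.1 h5).2⟩
    · exact ⟨h1 i, fun h => h5 (h3.2 ⟨h4, h⟩)⟩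
    · exact h1 i

theorem piece_meas {N : ℕ} (G : Fin N → Set Plane) (hG : ∀ i, MeasurableSet (G i))
    (S S' : Finset (Fin N)) (Q : Set Plane) (hQ : MeasurableSet Q) (i : Fin N) :
    MeasurableSet (piece G S S' Q i) := by
  unfold piece
  split_ifs
  · exact (hG i).inter hQ
  · exact (hG i).diff hQ
  · exact hG i

theorem piece_bdd {N : ℕ} (G : Fin N → Set Plane) (hG : ∀ i, Bornology.IsBounded (G i))
    (S S' : Finset (Fin N)) (Q : Set Plane) (i : Fin N) :
    Bornology.IsBounded (piece G S S' Q i) := by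
  unfold piece
  split_ifs
  · exact (hG i).subset inter_subset_left
  · exact (hG i).subset sdiff_subset
  · exact hG i

theorem piece_int {N : ℕ} (G : Fin N → Set Plane) (hG : ∀ i, MeasurableSet (G i))
    (hb : ∀ i, Bornology.IsBounded (G i))
    (S : Finset (Fin N)) (Q : Set Plane) (hQ : MeasurableSet Q)
    (F : Finset (Fin N) → Config N → ℝ) (hF : ∀ S', Continuous (F S')) :
    IntegrableOn (fun x => F (occ S Q x) x) (univ.pi G) ∧
    ∫ x in univ.pi G, F (occ S Q x) x
      = ∑ S' ∈ S.powerset, ∫ x in univ.pi (piece G S S' Q), F S' x := by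
  have hun : univ.pi G = ⋃ S' ∈ S.powerset, univ.pi (piece G S S' Q) := by
    ext x
    simp only [mem_iUnion, Finset.mem_powerset, exists_prop]
    constructor
    · intro h
      have hs : occ S Q x ⊆ S := by
        classical
        intro i hi
        simp only [occ, Finset.mem_filter] at hi
        exact hi.1
      exact ⟨occ S Q x, hs, (mem_piece G S _ hs Q x).2 ⟨h, rfl⟩⟩
    · rintro ⟨S', hs, h⟩
      exact ((mem_piece G S _ hs Q x).1 h).1
  have hm : ∀ S', MeasurableSet (univ.pi (piece G S S' Q)) := fun S' =>
    MeasurableSet.univ_pi (piece_meas G hG S S' Q hQ)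
  have hI : ∀ S' ∈ S.powerset, IntegrableOn (fun x => F (occ S Q x) x) (univ.pi (piece G S S' Q)) := by
    intro S' hS'
    refine (int_pi _ (piece_bdd G hb S S' Q) (F S') (hF S')).congr_fun ?_ (hm S')
    intro x hx
    simp only [((mem_piece G S S' (Finset.mem_powerset.1 hS') Q x).1 hx).2]
  constructor
  · rw [hun, integrableOn_finset_iUnion]; exact hI
  · conv_lhs => rw [hun]
    rw [integral_biUnion_finset _ (fun S' _ => hm S') ?_ hI]
    · refine Finset.sum_congr rfl fun S' hS' => setIntegral_congr_fun (hm S') fun x hx => ?_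
      simp only [((mem_piece G S S' (Finset.mem_powerset.1 hS') Q x).1 hx).2]
    · intro S1 h1 S2 h2 h12
      simp only [Finset.coe_powerset, mem_preimage, mem_powerset_iff, Finset.coe_subset] at h1 h2
      refine disjoint_left.2 fun x hx1 hx2 => h12 ?_
      rw [← ((mem_piece G S S1 h1 Q x).1 hx1).2, ← ((mem_piece G S S2 h2 Q x).1 hx2).2]

theorem part1 (K : ℕ) (hK : 0 < K) (a l t : ℝ) (hl : 0 < l) (ht : t ∈ Ioc a (a + l)) :
    ∃! p : Fin K, t ∈ Ioc (a + p * (l / K)) (a + p * (l / K) + l / K) := by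
  have hK0 : (0 : ℝ) < K := by exact_mod_cast hK
  have hlK : 0 < l / K := by positivity
  set y := (t - a) / (l / K) with hy
  have hty : t = a + y * (l / K) := by rw [hy]; field_simp; ring
  have hy0 : 0 < y := by rw [hy]; exact div_pos (by linarith [ht.1]) hlK
  have hyK : y ≤ K := by
    rw [hy, div_le_iff₀ hlK]
    have : (K : ℝ) * (l / K) = l := by field_simp
    rw [this]; linarith [ht.2]
  have key : ∀ p : ℕ, t ∈ Ioc (a + p * (l / K)) (a + p * (l / K) + l / K) ↔ (p : ℝ) < y ∧ y ≤ p + 1 := by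
    intro p
    rw [mem_Ioc, hty]
    constructor
    · rintro ⟨h1, h2⟩
      constructor
      · by_contra! h; nlinarith
      · by_contra! h; nlinarith
    · rintro ⟨h1, h2⟩
      constructor <;> nlinarith
  have hc1 : 0 < ⌈y⌉₊ := Nat.ceil_pos.2 hy0
  have hc2 : ⌈y⌉₊ ≤ K := Nat.ceil_le.2 hyK
  refine ⟨⟨⌈y⌉₊ - 1, by omega⟩, (key _).2 ?_, ?_⟩
  · have e : ((⌈y⌉₊ - 1 : ℕ) : ℝ) = (⌈y⌉₊ : ℝ) - 1 := by rw [Nat.cast_sub hc1]; simp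
    simp only [e]
    have := Nat.ceil_lt_add_one hy0.le
    have := Nat.le_ceil y
    constructor <;> linarith
  · intro p hp
    have := (key p).1 hp
    apply Fin.ext
    have h1 : ⌈y⌉₊ = (p : ℕ) + 1 := by
      rw [Nat.ceil_eq_iff (by omega)]
      push_cast
      simpa using this
    simp [h1]

/-- Sub-boxes. -/
def sbx (a b l : ℝ) (K : ℕ) (p : Fin K × Fin K) : Set Plane :=
  bx (a + p.1 * (l / K)) (b + p.2 * (l / K)) (l / K)

theorem part2 (K : ℕ) (hK : 0 < K) (a b l : ℝ) (hl : 0 < l) (z : Plane) (hz : z ∈ bx a b l) :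
    ∃! p : Fin K × Fin K, z ∈ sbx a b l K p := by
  obtain ⟨p, hp, hp'⟩ := part1 K hK a l z.1 hl hz.1
  obtain ⟨q, hq, hq'⟩ := part1 K hK b l z.2 hl hz.2
  refine ⟨(p, q), ⟨hp, hq⟩, ?_⟩
  rintro ⟨p', q'⟩ ⟨h1, h2⟩
  rw [hp' p' h1, hq' q' h2]

theorem sbx_subset (K : ℕ) (hK : 0 < K) (a b l : ℝ) (hl : 0 < l) (p : Fin K × Fin K) :
    sbx a b l K p ⊆ bx a b l := by
  have hK0 : (0 : ℝ) < K := by exact_mod_cast hK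
  have aux : ∀ (c : ℝ) (p : Fin K), Ioc (c + p * (l / K)) (c + p * (l / K) + l / K) ⊆ Ioc c (c + l) := by
    intro c p
    have h1 : ((p : ℕ) : ℝ) + 1 ≤ K := by exact_mod_cast p.2
    have hlK : 0 < l / K := by positivity
    have : (K : ℝ) * (l / K) = l := by field_simp
    refine Ioc_subset_Ioc ?_ ?_
    · have : 0 ≤ ((p : ℕ) : ℝ) * (l / K) := by positivity
      linarith
    · nlinarith
  exact prod_mono (aux _ _) (aux _ _)

theorem sum_occ (N : ℕ) (K : ℕ) (hK : 0 < K) (a b l : ℝ) (hl : 0 < l) (S : Finset (Fin N))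
    (x : Config N) (hx : ∀ i ∈ S, x i ∈ bx a b l) :
    ∑ p : Fin K × Fin K, (occ S (sbx a b l K p) x).card = S.card := by
  classical
  simp only [occ, Finset.card_filter]
  rw [Finset.sum_comm]
  have : ∀ i ∈ S, (∑ p : Fin K × Fin K, if x i ∈ sbx a b l K p then 1 else 0) = 1 := by
    intro i hi
    obtain ⟨p, hp, hp'⟩ := part2 K hK a b l hl (x i) (hx i hi)
    rw [Finset.sum_eq_single p]
    · simp [hp]
    · intro q _ hqp
      rw [if_neg fun h => hqp (hp' q h)]
    · simp
  rw [Finset.sum_congr rfl this]; simp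

open Classical in
theorem subdivide (N : ℕ) (Ψ : Config N → ℂ) (hΨ : Admissible N Ψ) (α : ℝ) (n K : ℕ) (hK : 0 < K)
    (c : ℕ → ℝ) (C : ℝ) (hc : ∀ m ≤ n, Bd N α Ψ m (c m))
    (hC : ∀ m : Fin K × Fin K → ℕ, ∑ p, m p = n → C ≤ (K : ℝ) ^ 2 * ∑ p, c (m p)) :
    Bd N α Ψ n C := by
  intro a b l hl S hcard G hG hb hS hS'
  have hΨc : Continuous Ψ := hΨ.smooth.continuous
  have hgc : Continuous fun x => ‖Ψ x‖ ^ 2 := by fun_prop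
  have hDc := fun j => continuous_DSq N Ψ hΨ α j
  have hK0 : (0 : ℝ) < K := by exact_mod_cast hK
  have hQm : ∀ p, MeasurableSet (sbx a b l K p) := fun p => bx_meas _ _ _
  have hpm : MeasurableSet (univ.pi G) := MeasurableSet.univ_pi hG
  have hin : ∀ x ∈ univ.pi G, ∀ i ∈ S, x i ∈ bx a b l := fun x hx i hi => hS i hi ▸ hx i (mem_univ i)
  have P1 := fun p => piece_int G hG hb S (sbx a b l K p) (hQm p)
    (fun S' x => c S'.card * ‖Ψ x‖ ^ 2) (fun S' => by fun_prop)
  have P2 := fun p (j : Fin N) => piece_int G hG hb S (sbx a b l K p) (hQm p)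
    (fun S' x => (if j ∈ S' then 1 else 0) * DSq N α j Ψ x)
    (fun S' => continuous_const.mul (hDc j))
  -- local bounds
  have hloc : ∀ p, ∫ x in univ.pi G, c (occ S (sbx a b l K p) x).card * ‖Ψ x‖ ^ 2
      ≤ (l / K) ^ 2 * ∑ j ∈ S, ∫ x in univ.pi G,
        (if j ∈ occ S (sbx a b l K p) x then 1 else 0) * DSq N α j Ψ x := by
    intro p
    rw [(P1 p).2, Finset.sum_congr rfl fun j _ => (P2 p j).2, Finset.sum_comm, Finset.mul_sum]
    refine Finset.sum_le_sum fun S' hS'' => ?_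
    have hsub := Finset.mem_powerset.1 hS''
    have h1 := hc S'.card (by rw [← hcard]; exact Finset.card_le_card hsub)
      (a + p.1 * (l / K)) (b + p.2 * (l / K)) (l / K) (by positivity) S' rfl
      (piece G S S' (sbx a b l K p)) (piece_meas G hG S S' _ (hQm p)) (piece_bdd G hb S S' _) ?_ ?_
    · rw [integral_const_mul]
      refine h1.trans (le_of_eq ?_)
      congr 1
      simp_rw [integral_const_mul, ite_mul, one_mul, zero_mul]
      rw [← Finset.sum_filter]
      congr 1
      ext i; simp only [Finset.mem_filter]; exact ⟨fun h => ⟨hsub h, h⟩, fun h => h.2⟩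
    · intro i hi
      simp only [piece, hsub hi, hi, if_true, hS i (hsub hi)]
      exact inter_eq_right.2 (sbx_subset K hK a b l hl p)
    · intro i hi
      simp only [piece, hi, if_false]
      split_ifs with h
      · exact disjoint_sdiff_left
      · exact (hS' i h).mono_right (sbx_subset K hK a b l hl p)
  have hsum := Finset.sum_le_sum fun p (_ : p ∈ Finset.univ) => hloc p
  rw [← integral_finsetSum _ (fun p _ => (P1 p).1), ← Finset.mul_sum, Finset.sum_comm] at hsum
  have hR : ∀ j ∈ S, ∑ p, ∫ x in univ.pi G,
        (if j ∈ occ S (sbx a b l K p) x then 1 else 0) * DSq N α j Ψ x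
      = ∫ x in univ.pi G, DSq N α j Ψ x := by
    intro j hj
    rw [← integral_finsetSum _ (fun p _ => (P2 p j).1)]
    refine setIntegral_congr_fun hpm fun x hx => ?_
    rw [← Finset.sum_mul]
    obtain ⟨p, hp, hp'⟩ := part2 K hK a b l hl (x j) (hin x hx j hj)
    rw [Finset.sum_eq_single p]
    · rw [if_pos, one_mul]; simp [occ, hj, hp]
    · intro q _ hqp
      rw [if_neg]
      simp only [occ, Finset.mem_filter, not_and]
      exact fun _ h => hqp (hp' q h)
    · simp
  rw [Finset.sum_congr rfl hR] at hsum
  have hL : C / (K : ℝ) ^ 2 * ∫ x in univ.pi G, ‖Ψ x‖ ^ 2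
      ≤ ∫ x in univ.pi G, ∑ p, c (occ S (sbx a b l K p) x).card * ‖Ψ x‖ ^ 2 := by
    rw [← integral_const_mul]
    refine setIntegral_mono_on ((int_pi G hb _ hgc).const_mul _)
      (integrable_finsetSum _ fun p _ => (P1 p).1) hpm ?_
    intro x hx
    rw [← Finset.sum_mul]
    refine mul_le_mul_of_nonneg_right ?_ (by positivity)
    rw [div_le_iff₀ (by positivity)]
    have := hC (fun p => (occ S (sbx a b l K p) x).card) (by
      rw [sum_occ N K hK a b l hl S x (hin x hx), hcard])
    linarith
  have := hL.trans hsum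
  rw [div_mul_eq_mul_div, div_le_iff₀ (by positivity)] at this
  refine this.trans (le_of_eq ?_)
  field_simp

theorem Bd_mono {N : ℕ} {α : ℝ} {Ψ : Config N → ℂ} {n : ℕ} {c c' : ℝ} (h : Bd N α Ψ n c)
    (hc : c' ≤ c) : Bd N α Ψ n c' := by
  intro a b l hl S hcard G hG hb hS hS'
  refine le_trans ?_ (h a b l hl S hcard G hG hb hS hS')
  exact mul_le_mul_of_nonneg_right hc (integral_nonneg fun x => by positivity)

theorem Bd_zero {N : ℕ} {α : ℝ} {Ψ : Config N → ℂ} {n : ℕ} : Bd N α Ψ n 0 := by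
  intro a b l hl S hcard G hG hb hS hS'
  rw [zero_mul]
  refine mul_nonneg (by positivity) (Finset.sum_nonneg fun j _ => ?_)
  exact integral_nonneg fun x => DSq_nonneg _ _ _ _ _

theorem s_bounds (α s : ℝ) (hα : 0 < α) (hα1 : α ≤ 1 / 10 ^ 10) (hs : s = Real.sin (π * α) / π) :
    9 / 10 * α ≤ s := by
  have hp := Real.pi_pos
  have hp4 := Real.pi_lt_four
  have hx : π * α ≤ 1 / 10 := by nlinarith
  have hx0 : 0 < π * α := by positivity
  have h := Real.sin_gt_sub_cube hx0
  rw [hs, le_div_iff₀ hp]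
  have : (π * α) ^ 3 ≤ (π * α) * (1 / 10) := by
    have : (π * α) ^ 2 ≤ 1 / 10 := by nlinarith
    nlinarith
  nlinarith

theorem Bd_small (N : ℕ) (Ψ : Config N → ℂ) (hΨ : Admissible N Ψ) (α : ℝ) (hα : 0 < α)
    (hα1 : α ≤ 1 / 10 ^ 10) (n : ℕ) (hn : 2 ≤ n) (hn4 : n ≤ 4) :
    Bd N α Ψ n (π * α * ((n - 1 : ℕ) : ℝ)) := by
  set s := Real.sin (π * α) / π with hs
  have hs9 := s_bounds α s hα hα1 hs
  have hs0 : 0 < s := by linarith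
  refine Bd_mono (local_bd N Ψ hΨ α s hs hs0 (1 / 4800) (by norm_num) n hn) ?_
  have hp := Real.pi_lt_d2
  have hp0 := Real.pi_pos
  have h1 : α * (5 / (16 * s)) ≤ 50 / 144 := by
    rw [mul_div_assoc', div_le_div_iff₀ (by positivity) (by norm_num)]
    nlinarith
  rw [le_div_iff₀ (by positivity)]
  have hD : α * (5 / (16 * s) + 6 / (1 / 4800) ^ 2 + 4 * ((n : ℝ) + 2) * (1 / 4800)) ≤ 37 / 100 := by
    have : ((n : ℝ)) ≤ 4 := by exact_mod_cast hn4
    have : α * (6 / (1 / 4800) ^ 2 + 4 * ((n : ℝ) + 2) * (1 / 4800)) ≤ 2 / 100 := by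
      have h2 : (6 / (1 / 4800) ^ 2 + 4 * ((n : ℝ) + 2) * (1 / 4800)) ≤ 139000000 := by
        norm_num; linarith
      have h3 : α * (6 / (1 / 4800) ^ 2 + 4 * ((n : ℝ) + 2) * (1 / 4800)) ≤ α * 139000000 :=
        mul_le_mul_of_nonneg_left h2 hα.le
      linarith
    rw [add_assoc, mul_add]
    linarith
  have hD0 : 0 ≤ α * (5 / (16 * s) + 6 / (1 / 4800) ^ 2 + 4 * ((n : ℝ) + 2) * (1 / 4800)) := by
    positivity
  set D := α * (5 / (16 * s) + 6 / (1 / 4800) ^ 2 + 4 * ((n : ℝ) + 2) * (1 / 4800)) with hDd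
  have e : π * α * ((n - 1 : ℕ) : ℝ) * (5 / (16 * s) + 6 / (1 / 4800) ^ 2 + 4 * ((n : ℝ) + 2) * (1 / 4800))
      = π * D * ((n - 1 : ℕ) : ℝ) := by rw [hDd]; ring
  rw [e]
  have hpD : π * D ≤ 117 / 100 := by nlinarith
  interval_cases n <;> norm_num <;> nlinarith

theorem Bd_pos (N : ℕ) (Ψ : Config N → ℂ) (hΨ : Admissible N Ψ) (α : ℝ) (hα : 0 < α)
    (hα1 : α ≤ 1 / 10 ^ 10) (n : ℕ) (hn : 2 ≤ n) : ∃ c, 0 < c ∧ Bd N α Ψ n c := by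
  set s := Real.sin (π * α) / π with hs
  have hs9 := s_bounds α s hα hα1 hs
  have hs0 : 0 < s := by linarith
  refine ⟨_, ?_, local_bd N Ψ hΨ α s hs hs0 (1 / (16 * (n + 2))) (by positivity) n hn⟩
  have hn0 : (0 : ℝ) < n := by exact_mod_cast (by omega : 0 < n)
  have : 1 - 8 * ((n : ℝ) + 2) * (1 / (16 * (n + 2))) = 1 / 2 := by field_simp; norm_num
  rw [this]
  positivity

theorem Bd_step (N : ℕ) (Ψ : Config N → ℂ) (hΨ : Admissible N Ψ) (α : ℝ) (A : ℝ) (hA : 0 < A)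
    (n : ℕ) (hn : 5 ≤ n) (ih : ∀ m < n, Bd N α Ψ m (A * ((m - 1 : ℕ) : ℝ))) (c : ℝ) (hc0 : 0 ≤ c)
    (hc : Bd N α Ψ n c) : Bd N α Ψ n (min (4 * c) (A * ((n - 1 : ℕ) : ℝ))) := by
  classical
  refine subdivide N Ψ hΨ α n 2 (by norm_num) (fun m => if m < n then A * ((m - 1 : ℕ) : ℝ) else c) _
    ?_ ?_
  · intro m hm
    split_ifs with h
    · exact ih m h
    · have : m = n := by omega
      rw [this]; exact hc
  · intro m hm
    have hnn : ∀ p, 0 ≤ (if m p < n then A * ((m p - 1 : ℕ) : ℝ) else c) := by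
      intro p; split_ifs <;> positivity
    by_cases hex : ∃ p, ¬ m p < n
    · obtain ⟨p, hp⟩ := hex
      have := Finset.single_le_sum (fun q _ => hnn q) (Finset.mem_univ p)
      simp only [hp, if_false] at this
      refine (min_le_left _ _).trans ?_
      push_cast
      linarith
    · push Not at hex
      refine (min_le_right _ _).trans ?_
      have e : ∀ p, (if m p < n then A * ((m p - 1 : ℕ) : ℝ) else c) = A * ((m p - 1 : ℕ) : ℝ) :=
        fun p => if_pos (hex p)
      simp only [e]
      rw [← Finset.mul_sum]
      have h1 : ∑ p : Fin 2 × Fin 2, m p ≤ ∑ p : Fin 2 × Fin 2, (m p - 1) + 4 := by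
        calc ∑ p : Fin 2 × Fin 2, m p ≤ ∑ p : Fin 2 × Fin 2, ((m p - 1) + 1) :=
              Finset.sum_le_sum fun p _ => by omega
          _ = _ := by rw [Finset.sum_add_distrib]; simp
      have h2 : (n - 1) ≤ 4 * ∑ p : Fin 2 × Fin 2, (m p - 1) := by omega
      have h3 : ((n - 1 : ℕ) : ℝ) ≤ 4 * ∑ p : Fin 2 × Fin 2, ((m p - 1 : ℕ) : ℝ) := by
        exact_mod_cast h2
      have := mul_le_mul_of_nonneg_left h3 hA.le
      push_cast
      linarith

theorem Bd_all (N : ℕ) (Ψ : Config N → ℂ) (hΨ : Admissible N Ψ) (α : ℝ) (hα : 0 < α)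
    (hα1 : α ≤ 1 / 10 ^ 10) (n : ℕ) : Bd N α Ψ n (π * α * ((n - 1 : ℕ) : ℝ)) := by
  induction n using Nat.strong_induction_on with
  | _ n ih =>
    by_cases h2 : n < 2
    · have : n - 1 = 0 := by omega
      rw [this]; simpa using Bd_zero
    by_cases h4 : n ≤ 4
    · exact Bd_small N Ψ hΨ α hα hα1 n (by omega) h4
    have hA : 0 < π * α := by positivity
    obtain ⟨c, hc0, hc⟩ := Bd_pos N Ψ hΨ α hα hα1 n (by omega)
    have hit : ∀ k : ℕ, Bd N α Ψ n (min (4 ^ k * c) (π * α * ((n - 1 : ℕ) : ℝ))) := by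
      intro k
      induction k with
      | zero => exact Bd_mono hc (by simp)
      | succ k ihk =>
        have hm0 : 0 ≤ min (4 ^ k * c) (π * α * ((n - 1 : ℕ) : ℝ)) := le_min (by positivity) (by positivity)
        refine Bd_mono (Bd_step N Ψ hΨ α _ hA n (by omega) ih _ hm0 ihk) ?_
        rcases min_cases (4 ^ k * c) (π * α * ((n - 1 : ℕ) : ℝ)) with ⟨e, h⟩ | ⟨e, h⟩
        · rw [e]; exact le_of_eq (by ring_nf)
        · rw [e]
          refine (min_le_right _ _).trans (le_min ?_ le_rfl)
          have : 0 ≤ π * α * ((n - 1 : ℕ) : ℝ) := by positivity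
          linarith
    obtain ⟨k, hk⟩ := pow_unbounded_of_one_lt (π * α * ((n - 1 : ℕ) : ℝ) / c) (by norm_num : (1 : ℝ) < 4)
    have := hit k
    rwa [min_eq_right] at this
    rw [div_lt_iff₀ hc0] at hk
    exact hk.le

theorem Bd_final (N : ℕ) (Ψ : Config N → ℂ) (hΨ : Admissible N Ψ) (α : ℝ) (hα : 0 < α)
    (hα1 : α ≤ 1 / 10 ^ 10) (K : ℕ) (hK : 0 < K) :
    Bd N α Ψ N ((K : ℝ) ^ 2 * (π * α * ((N : ℝ) - (K : ℝ) ^ 2))) := by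
  refine subdivide N Ψ hΨ α N K hK (fun m => π * α * ((m - 1 : ℕ) : ℝ)) _
    (fun m _ => Bd_all N Ψ hΨ α hα hα1 m) ?_
  intro m hm
  rw [← Finset.mul_sum]
  refine mul_le_mul_of_nonneg_left ?_ (by positivity)
  refine mul_le_mul_of_nonneg_left ?_ (by positivity)
  have : ∀ p, (m p : ℝ) - 1 ≤ ((m p - 1 : ℕ) : ℝ) := by
    intro p
    have : m p ≤ (m p - 1) + 1 := by omega
    have : (m p : ℝ) ≤ ((m p - 1 : ℕ) : ℝ) + 1 := by exact_mod_cast this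
    linarith
  refine le_trans (le_of_eq ?_) (Finset.sum_le_sum fun p _ => this p)
  rw [Finset.sum_sub_distrib, ← hm]
  simp [sq]

theorem bx_ae_Q0 : bx 0 0 1 =ᵐ[volume] Q0 := by
  have h : Ioc (0 : ℝ) (0 + 1) =ᵐ[volume] Ioo (0 : ℝ) 1 := by
    rw [zero_add]; exact Ioo_ae_eq_Ioc.symm
  exact Measure.set_prod_ae_eq h h

theorem cube_ae (N : ℕ) : (univ.pi fun _ : Fin N => bx 0 0 1) =ᵐ[volume] cube N Q0 :=
  Measure.ae_eq_set_pi fun _ _ => bx_ae_Q0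

theorem kinE_lower (N : ℕ) (Ψ : Config N → ℂ) (hΨ : Admissible N Ψ) (α : ℝ) (hα : 0 < α)
    (hα1 : α ≤ 1 / 10 ^ 10) (K : ℕ) (hK : 0 < K) :
    (K : ℝ) ^ 2 * (π * α * ((N : ℝ) - (K : ℝ) ^ 2)) * normSq N Q0 Ψ ≤ kinE N α Q0 Ψ := by
  have h := Bd_final N Ψ hΨ α hα hα1 K hK 0 0 1 one_pos Finset.univ (by simp)
    (fun _ => bx 0 0 1) (fun _ => bx_meas _ _ _) (fun _ => bx_bdd _ _ _) (fun _ _ => rfl)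
    (fun i hi => absurd (Finset.mem_univ i) hi)
  rw [one_pow, one_mul] at h
  unfold normSq kinE
  rw [← setIntegral_congr_set (cube_ae N)]
  simp_rw [← setIntegral_congr_set (cube_ae N)]
  exact h

/-- Identification of the plane with `ℂ`. -/
def toC : Plane →L[ℝ] ℂ := (Complex.equivRealProdCLM.symm : Plane →L[ℝ] ℂ)

theorem toC_apply (v : Plane) : toC v = ⟨v.1, v.2⟩ := by
  apply Complex.ext <;> rfl

/-- Difference of two particles as a complex number. -/
def dC {N : ℕ} (a b : Fin N) : Config N →L[ℝ] ℂ :=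
  toC.comp (ContinuousLinearMap.proj (R := ℝ) (φ := fun _ : Fin N => Plane) b
    - ContinuousLinearMap.proj (R := ℝ) (φ := fun _ : Fin N => Plane) a)

theorem dC_apply {N : ℕ} (a b : Fin N) (x : Config N) : dC a b x = toC (x b - x a) := by
  simp [dC]

/-- The gauge phase. -/
def theta {N : ℕ} (τ : Equiv.Perm (Fin N)) (x : Config N) : ℝ :=
  ∑ a, ∑ b, if τ a < τ b then (Complex.log (dC a b x)).im else 0

/-- The gauged trial function. -/
def phi {N : ℕ} (α : ℝ) (f : Fin N → Plane → ℝ) (τ : Equiv.Perm (Fin N)) (x : Config N) : ℂ :=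
  (∏ i, (f (τ i) (x i) : ℂ)) * Complex.exp (((-(α * theta τ x) : ℝ) : ℂ) * Complex.I)

theorem logim_deriv {N : ℕ} (a b : Fin N) (x : Config N) (h : dC a b x ∈ Complex.slitPlane) :
    ∃ T : Config N →L[ℝ] ℝ, HasFDerivAt (fun y => (Complex.log (dC a b y)).im) T x ∧
      ∀ u, T u = (dC a b u / dC a b x).im := by
  have h1 := ((Complex.hasStrictDerivAt_log h).hasDerivAt.hasFDerivAt.restrictScalars ℝ)
  have h2 := h1.comp x (dC a b).hasFDerivAt
  have h3 := Complex.imCLM.hasFDerivAt.comp x h2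
  refine ⟨_, h3, ?_⟩
  intro u
  simp [div_eq_mul_inv]

theorem logim_smooth {N : ℕ} (a b : Fin N) (x : Config N) (h : dC a b x ∈ Complex.slitPlane) :
    ContDiffAt ℝ (⊤ : ℕ∞) (fun y => (Complex.log (dC a b y)).im) x := by
  have h1 : ContDiffAt ℝ (⊤ : ℕ∞) Complex.log (dC a b x) :=
    (Complex.contDiffAt_log h).restrict_scalars ℝ
  have h2 := h1.comp x (dC a b).contDiff.contDiffAt
  exact Complex.imCLM.contDiff.contDiffAt.comp x h2

theorem theta_smooth {N : ℕ} (τ : Equiv.Perm (Fin N)) (x : Config N)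
    (h : ∀ a b, τ a < τ b → dC a b x ∈ Complex.slitPlane) :
    ContDiffAt ℝ (⊤ : ℕ∞) (theta τ) x := by
  unfold theta
  refine ContDiffAt.sum fun a _ => ContDiffAt.sum fun b _ => ?_
  by_cases hab : τ a < τ b
  · simp only [hab, if_true]; exact logim_smooth a b x (h a b hab)
  · simp only [hab, if_false]; exact contDiffAt_const

theorem theta_deriv {N : ℕ} (τ : Equiv.Perm (Fin N)) (x : Config N)
    (h : ∀ a b, τ a < τ b → dC a b x ∈ Complex.slitPlane) :
    ∃ T : Config N →L[ℝ] ℝ, HasFDerivAt (theta τ) T x ∧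
      ∀ j v, T (Pi.single j v) = ∑ k ∈ Finset.univ.erase j, (toC v / toC (x j - x k)).im := by
  have hex : ∀ a b, ∃ T : Config N →L[ℝ] ℝ,
      HasFDerivAt (fun y => if τ a < τ b then (Complex.log (dC a b y)).im else 0) T x ∧
      ∀ u, T u = if τ a < τ b then (dC a b u / dC a b x).im else 0 := by
    intro a b
    by_cases hab : τ a < τ b
    · simp only [hab, if_true]; exact logim_deriv a b x (h a b hab)
    · simp only [hab, if_false]; exact ⟨0, hasFDerivAt_const _ _, fun u => rfl⟩
  choose T hT hT' using hex
  refine ⟨∑ a, ∑ b, T a b, HasFDerivAt.fun_sum fun a _ => HasFDerivAt.fun_sum fun b _ => hT a b, ?_⟩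
  intro j v
  simp only [ContinuousLinearMap.sum_apply, hT', dC_apply]
  have key : ∀ a b : Fin N, (if τ a < τ b then
      (toC ((Pi.single j v : Config N) b - (Pi.single j v : Config N) a) / toC (x b - x a)).im else 0)
      = (if b = j then (if τ a < τ j then (toC v / toC (x j - x a)).im else 0) else 0)
        + (if a = j then (if τ j < τ b then (toC v / toC (x j - x b)).im else 0) else 0) := by
    intro a b
    by_cases ha : a = j <;> by_cases hb : b = j
    · subst ha; subst hb; simp
    · subst ha
      simp only [hb, if_false, if_true, zero_add]
      rw [Pi.single_eq_same, Pi.single_eq_of_ne hb, zero_sub, map_neg, ← neg_sub (x a) (x b), map_neg,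
        neg_div_neg_eq]
    · subst hb
      simp only [ha, if_false, if_true, add_zero]
      rw [Pi.single_eq_same, Pi.single_eq_of_ne ha, sub_zero]
    · simp only [ha, hb, if_false, add_zero]
      rw [Pi.single_eq_of_ne hb, Pi.single_eq_of_ne ha]
      simp
  simp only [key, Finset.sum_add_distrib]
  have e1 : ∑ a, ∑ b, (if b = j then (if τ a < τ j then (toC v / toC (x j - x a)).im else 0) else 0)
      = ∑ a, (if τ a < τ j then (toC v / toC (x j - x a)).im else 0) := by
    refine Finset.sum_congr rfl fun a _ => ?_
    rw [Finset.sum_ite_eq' Finset.univ j]; simp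
  have e2 : ∑ a, ∑ b, (if a = j then (if τ j < τ b then (toC v / toC (x j - x b)).im else 0) else 0)
      = ∑ b, (if τ j < τ b then (toC v / toC (x j - x b)).im else 0) := by
    rw [Finset.sum_comm]
    refine Finset.sum_congr rfl fun b _ => ?_
    rw [Finset.sum_ite_eq' Finset.univ j]; simp
  rw [e1, e2, ← Finset.sum_add_distrib, ← Finset.add_sum_erase _ _ (Finset.mem_univ j)]
  simp only [lt_irrefl, if_false, add_zero, zero_add]
  refine Finset.sum_congr rfl fun k hk => ?_
  have hne : τ k ≠ τ j := fun e => (Finset.ne_of_mem_erase hk) (τ.injective e)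
  rcases lt_or_gt_of_ne hne with h1 | h1
  · simp [h1, not_lt.2 h1.le]
  · simp [h1, not_lt.2 h1.le]

theorem abPot_im {N : ℕ} (j : Fin N) (x : Config N) :
    (abPot N j x).1 = ∑ k ∈ Finset.univ.erase j, (toC (1, 0) / toC (x j - x k)).im ∧
    (abPot N j x).2 = ∑ k ∈ Finset.univ.erase j, (toC (0, 1) / toC (x j - x k)).im := by
  unfold abPot
  rw [Prod.fst_sum, Prod.snd_sum]
  constructor
  · refine Finset.sum_congr rfl fun k _ => ?_
    simp only [perpInv, toC_apply, Complex.div_im, Complex.normSq_mk]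
    ring
  · refine Finset.sum_congr rfl fun k _ => ?_
    simp only [perpInv, toC_apply, Complex.div_im, Complex.normSq_mk]
    ring

theorem prodf_deriv {N : ℕ} (f : Fin N → Plane → ℝ) (hf : ∀ i, ContDiff ℝ (⊤ : ℕ∞) (f i))
    (τ : Equiv.Perm (Fin N)) (x : Config N) :
    ∃ T : Config N →L[ℝ] ℂ, HasFDerivAt (fun y : Config N => ∏ i, (f (τ i) (y i) : ℂ)) T x ∧
      ∀ j v, T (Pi.single j v) = ((fderiv ℝ (f (τ j)) (x j) v *
        ∏ i ∈ Finset.univ.erase j, f (τ i) (x i) : ℝ) : ℂ) := by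
  have h1 : ∀ i ∈ (Finset.univ : Finset (Fin N)), HasFDerivAt (fun y : Config N => (f (τ i) (y i) : ℂ))
      (Complex.ofRealCLM.comp ((fderiv ℝ (f (τ i)) (x i)).comp
        (ContinuousLinearMap.proj (R := ℝ) (φ := fun _ : Fin N => Plane) i))) x := by
    intro i _
    have ha : HasFDerivAt (f (τ i)) (fderiv ℝ (f (τ i)) (x i)) (x i) :=
      ((hf (τ i)).differentiable (by simp) (x i)).hasFDerivAt
    have hb := ha.comp x (ContinuousLinearMap.proj (R := ℝ) (φ := fun _ : Fin N => Plane) i).hasFDerivAt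
    exact Complex.ofRealCLM.hasFDerivAt.comp x hb
  refine ⟨_, HasFDerivAt.finsetProd h1, ?_⟩
  intro j v
  simp only [ContinuousLinearMap.sum_apply]
  rw [Finset.sum_eq_single j]
  · simp [mul_comm]
  · intro i _ hij
    simp [Pi.single_eq_of_ne hij]
  · simp

theorem phi_DOp {N : ℕ} (α : ℝ) (f : Fin N → Plane → ℝ) (hf : ∀ i, ContDiff ℝ (⊤ : ℕ∞) (f i))
    (τ : Equiv.Perm (Fin N)) (x : Config N)
    (h : ∀ a b, τ a < τ b → dC a b x ∈ Complex.slitPlane) (j : Fin N) :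
    DSq N α j (phi α f τ) x = ((fderiv ℝ (f (τ j)) (x j) (1, 0)) ^ 2 +
      (fderiv ℝ (f (τ j)) (x j) (0, 1)) ^ 2) * ∏ i ∈ Finset.univ.erase j, (f (τ i) (x i)) ^ 2 := by
  obtain ⟨T, hT, hT'⟩ := theta_deriv τ x h
  obtain ⟨S, hS, hS'⟩ := prodf_deriv f hf τ x
  have hE : HasFDerivAt (fun y => ((-(α * theta τ y) : ℝ) : ℂ) * Complex.I)
      ((Complex.ofRealCLM.comp (-(α • T))).smulRight Complex.I) x := by
    have h1 : HasFDerivAt (fun y => -(α * theta τ y)) (-(α • T)) x := (hT.const_mul α).neg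
    have h2 := Complex.ofRealCLM.hasFDerivAt.comp x h1
    have h3 := h2.mul_const Complex.I
    refine h3.congr_fderiv ?_
    ext u
    simp [mul_comm]
  have hP := hS.mul hE.cexp
  have hpd : ∀ v, pder N j v (phi α f τ) x
      = Complex.exp (((-(α * theta τ x) : ℝ) : ℂ) * Complex.I) * S (Pi.single j v)
        - Complex.I * (α * (T (Pi.single j v) : ℂ)) * phi α f τ x := by
    intro v
    unfold pder
    have : fderiv ℝ (phi α f τ) x = _ := hP.fderiv
    rw [this]
    simp only [phi, ContinuousLinearMap.add_apply, ContinuousLinearMap.smul_apply,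
      ContinuousLinearMap.smulRight_apply, ContinuousLinearMap.comp_apply,
      ContinuousLinearMap.neg_apply, Complex.ofRealCLM_apply, smul_eq_mul]
    push_cast
    ring
  have hn : ∀ r : ℝ, ‖-Complex.I * (Complex.exp (((-(α * theta τ x) : ℝ) : ℂ) * Complex.I) * (r : ℂ))‖ ^ 2
      = r ^ 2 := by
    intro r
    rw [norm_mul, norm_mul, Complex.norm_exp_ofReal_mul_I]
    simp
  have hc : ∀ (v : Plane) (A : ℝ), A = T (Pi.single j v) →
      ‖-Complex.I * pder N j v (phi α f τ) x + Complex.ofReal (α * A) * phi α f τ x‖ ^ 2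
      = (fderiv ℝ (f (τ j)) (x j) v) ^ 2 * ∏ i ∈ Finset.univ.erase j, (f (τ i) (x i)) ^ 2 := by
    intro v A hA
    have e : -Complex.I * pder N j v (phi α f τ) x + Complex.ofReal (α * A) * phi α f τ x
        = -Complex.I * (Complex.exp (((-(α * theta τ x) : ℝ) : ℂ) * Complex.I) * S (Pi.single j v)) := by
      rw [hpd v, hA]
      push_cast
      have : Complex.I * Complex.I = -1 := Complex.I_mul_I
      linear_combination (α * (T (Pi.single j v) : ℂ) * phi α f τ x) * this
    rw [e, hS' j v, hn, mul_pow, Finset.prod_pow]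
  unfold DSq DOp
  rw [hc (1, 0) _ ((abPot_im j x).1.trans (hT' j (1, 0)).symm),
    hc (0, 1) _ ((abPot_im j x).2.trans (hT' j (0, 1)).symm)]
  ring

theorem phi_norm {N : ℕ} (α : ℝ) (f : Fin N → Plane → ℝ) (τ : Equiv.Perm (Fin N)) (x : Config N) :
    ‖phi α f τ x‖ ^ 2 = ∏ i, (f (τ i) (x i)) ^ 2 := by
  unfold phi
  rw [norm_mul, Complex.norm_exp_ofReal_mul_I, mul_one, norm_prod, ← Finset.prod_pow]
  refine Finset.prod_congr rfl fun i _ => ?_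
  simp

/-- Data for a trial state: bumps in well-ordered cells. -/
structure Cells (N : ℕ) (f : Fin N → Plane → ℝ) (B : Fin N → Set Plane) : Prop where
  smooth : ∀ i, ContDiff ℝ (⊤ : ℕ∞) (f i)
  supp : ∀ i, tsupport (f i) ⊆ B i
  slit : ∀ i k, i < k → ∀ x ∈ B i, ∀ y ∈ B k, toC (y - x) ∈ Complex.slitPlane

theorem Cells.slit' {N : ℕ} {f : Fin N → Plane → ℝ} {B : Fin N → Set Plane} (H : Cells N f B)
    (τ : Equiv.Perm (Fin N)) (x : Config N) (hx : ∀ i, x i ∈ B (τ i)) (a b : Fin N)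
    (hab : τ a < τ b) : dC a b x ∈ Complex.slitPlane := by
  rw [dC_apply]
  exact H.slit _ _ hab _ (hx a) _ (hx b)

theorem Cells.disj {N : ℕ} {f : Fin N → Plane → ℝ} {B : Fin N → Set Plane} (H : Cells N f B)
    (i k : Fin N) (z : Plane) (hi : z ∈ B i) (hk : z ∈ B k) : i = k := by
  rcases lt_trichotomy i k with h | h | h
  · have := H.slit i k h z hi z hk
    simp at this
  · exact h
  · have := H.slit k i h z hk z hi
    simp at this

theorem Cells.far {N : ℕ} {f : Fin N → Plane → ℝ} {B : Fin N → Set Plane} (H : Cells N f B) (α : ℝ)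
    (τ : Equiv.Perm (Fin N)) (x : Config N) (hx : ¬ ∀ i, x i ∈ B (τ i)) :
    phi α f τ =ᶠ[𝓝 x] 0 := by
  push Not at hx
  obtain ⟨i, hi⟩ := hx
  have h1 : f (τ i) =ᶠ[𝓝 (x i)] 0 := notMem_tsupport_iff_eventuallyEq.1 fun h => hi (H.supp _ h)
  have h2 : Filter.Tendsto (fun y : Config N => y i) (𝓝 x) (𝓝 (x i)) :=
    (continuous_apply i).continuousAt
  filter_upwards [h2.eventually h1] with y hy
  simp only [phi, Pi.zero_apply]
  rw [Finset.prod_eq_zero (Finset.mem_univ i), zero_mul]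
  simp [hy]

theorem Cells.phi_smooth {N : ℕ} {f : Fin N → Plane → ℝ} {B : Fin N → Set Plane} (H : Cells N f B)
    (α : ℝ) (τ : Equiv.Perm (Fin N)) : ContDiff ℝ (⊤ : ℕ∞) (phi α f τ) := by
  rw [contDiff_iff_contDiffAt]
  intro x
  by_cases hx : ∀ i, x i ∈ B (τ i)
  · have h1 := theta_smooth τ x (H.slit' τ x hx)
    unfold phi
    refine ContDiffAt.mul ?_ (ContDiffAt.cexp (ContDiffAt.mul ?_ contDiffAt_const))
    · refine contDiffAt_prod fun i _ => ?_
      have : ContDiff ℝ (⊤ : ℕ∞) fun y : Config N => f (τ i) (y i) :=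
        (H.smooth (τ i)).comp (contDiff_apply ℝ Plane i)
      exact (Complex.ofRealCLM.contDiff.comp this).contDiffAt
    · exact Complex.ofRealCLM.contDiff.contDiffAt.comp x ((contDiffAt_const.mul h1).neg)
  · exact contDiffAt_const.congr_of_eventuallyEq (H.far α τ x hx)

/-- The symmetrised trial state. -/
def trial {N : ℕ} (α : ℝ) (f : Fin N → Plane → ℝ) (x : Config N) : ℂ :=
  ∑ τ : Equiv.Perm (Fin N), phi α f τ x

theorem theta_perm {N : ℕ} (σ τ : Equiv.Perm (Fin N)) (x : Config N) :
    theta τ (x ∘ σ) = theta (σ⁻¹.trans τ) x := by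
  unfold theta
  rw [← Equiv.sum_comp σ⁻¹]
  refine Finset.sum_congr rfl fun a _ => ?_
  rw [← Equiv.sum_comp σ⁻¹]
  refine Finset.sum_congr rfl fun b _ => ?_
  simp [dC_apply]

theorem phi_perm {N : ℕ} (α : ℝ) (f : Fin N → Plane → ℝ) (σ τ : Equiv.Perm (Fin N)) (x : Config N) :
    phi α f τ (x ∘ σ) = phi α f (τ * σ⁻¹) x := by
  unfold phi
  rw [theta_perm]
  congr 1
  rw [← Equiv.prod_comp σ⁻¹]
  simp

theorem Cells.unique {N : ℕ} {f : Fin N → Plane → ℝ} {B : Fin N → Set Plane} (H : Cells N f B)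
    (σ τ : Equiv.Perm (Fin N)) (x : Config N) (h1 : ∀ i, x i ∈ B (σ i)) (h2 : ∀ i, x i ∈ B (τ i)) :
    σ = τ := by
  ext i
  rw [H.disj _ _ _ (h1 i) (h2 i)]

theorem Cells.admissible {N : ℕ} {f : Fin N → Plane → ℝ} {B : Fin N → Set Plane} (H : Cells N f B)
    (α : ℝ) : Admissible N (trial α f) where
  smooth := by
    unfold trial
    exact ContDiff.sum fun τ _ => H.phi_smooth α τ
  symm := by
    intro σ x
    unfold trial
    simp only [phi_perm]
    exact Equiv.sum_comp (Equiv.mulRight σ⁻¹) (fun τ => phi α f τ x)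
  vanishes := by
    refine ⟨(tsupport (trial α f))ᶜ, (isClosed_tsupport _).isOpen_compl, ?_, ?_⟩
    · rintro x ⟨j, k, hjk, e⟩
      rw [mem_compl_iff, notMem_tsupport_iff_eventuallyEq]
      have : ∀ τ : Equiv.Perm (Fin N), phi α f τ =ᶠ[𝓝 x] 0 := by
        intro τ
        refine H.far α τ x fun h => hjk ?_
        have h1 := h j
        rw [e] at h1
        exact τ.injective (H.disj _ _ _ h1 (h k))
      filter_upwards [Filter.eventually_all.2 this] with y hy
      simp [trial, hy]
    · intro x hx
      exact image_eq_zero_of_notMem_tsupport hx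

theorem sum_one_term {ι : Type*} [Fintype ι] (a : ι → ℂ)
    (h : ∀ i j, a i ≠ 0 → a j ≠ 0 → i = j) : ‖∑ i, a i‖ ^ 2 = ∑ i, ‖a i‖ ^ 2 := by
  by_cases hz : ∃ i, a i ≠ 0
  · obtain ⟨i, hi⟩ := hz
    have h0 : ∀ j, j ≠ i → a j = 0 := fun j hj => by
      by_contra hne; exact hj (h j i hne hi)
    rw [Fintype.sum_eq_single i h0, Fintype.sum_eq_single i fun j hj => by rw [h0 j hj]; simp]
  · push Not at hz
    simp [hz]

theorem Cells.norm_trial {N : ℕ} {f : Fin N → Plane → ℝ} {B : Fin N → Set Plane} (H : Cells N f B)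
    (α : ℝ) (x : Config N) :
    ‖trial α f x‖ ^ 2 = ∑ τ : Equiv.Perm (Fin N), ∏ i, (f (τ i) (x i)) ^ 2 := by
  unfold trial
  rw [sum_one_term]
  · exact Finset.sum_congr rfl fun τ _ => phi_norm α f τ x
  · intro σ τ h1 h2
    refine H.unique σ τ x ?_ ?_
    · by_contra h; exact h1 (H.far α σ x h).eq_of_nhds
    · by_contra h; exact h2 (H.far α τ x h).eq_of_nhds

theorem Cells.DSq_trial {N : ℕ} {f : Fin N → Plane → ℝ} {B : Fin N → Set Plane} (H : Cells N f B)
    (α : ℝ) (x : Config N) (j : Fin N) :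
    DSq N α j (trial α f) x = ∑ τ : Equiv.Perm (Fin N), ((fderiv ℝ (f (τ j)) (x j) (1, 0)) ^ 2 +
      (fderiv ℝ (f (τ j)) (x j) (0, 1)) ^ 2) * ∏ i ∈ Finset.univ.erase j, (f (τ i) (x i)) ^ 2 := by
  have hpd : ∀ v, pder N j v (trial α f) x = ∑ τ : Equiv.Perm (Fin N), pder N j v (phi α f τ) x := by
    intro v
    unfold pder trial
    rw [fderiv_fun_sum fun τ _ => (H.phi_smooth α τ).differentiable (by simp) x]
    simp
  have h0 : ∀ τ : Equiv.Perm (Fin N), (¬ ∀ i, x i ∈ B (τ i)) → phi α f τ x = 0 ∧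
      ∀ v, pder N j v (phi α f τ) x = 0 := by
    intro τ h
    have := H.far α τ x h
    refine ⟨this.eq_of_nhds, fun v => ?_⟩
    unfold pder
    rw [this.fderiv_eq]
    simp
  have hcomp : ∀ (v : Plane) (A : ℝ),
      ‖-Complex.I * pder N j v (trial α f) x + Complex.ofReal A * trial α f x‖ ^ 2
      = ∑ τ : Equiv.Perm (Fin N), ‖-Complex.I * pder N j v (phi α f τ) x + Complex.ofReal A * phi α f τ x‖ ^ 2 := by
    intro v A
    rw [hpd, trial, Finset.mul_sum, Finset.mul_sum, ← Finset.sum_add_distrib]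
    refine sum_one_term _ ?_
    intro σ τ h1 h2
    refine H.unique σ τ x ?_ ?_
    · by_contra h
      apply h1
      rw [(h0 σ h).1, (h0 σ h).2]; simp
    · by_contra h
      apply h2
      rw [(h0 τ h).1, (h0 τ h).2]; simp
  have hsum : DSq N α j (trial α f) x = ∑ τ : Equiv.Perm (Fin N), DSq N α j (phi α f τ) x := by
    unfold DSq DOp
    rw [hcomp, hcomp, ← Finset.sum_add_distrib]
  rw [hsum]
  refine Finset.sum_congr rfl fun τ _ => ?_
  by_cases hx : ∀ i, x i ∈ B (τ i)
  · exact phi_DOp α f H.smooth τ x (H.slit' τ x hx) j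
  · have hL : DSq N α j (phi α f τ) x = 0 := by
      unfold DSq DOp
      rw [(h0 τ hx).1, (h0 τ hx).2, (h0 τ hx).2]
      simp
    rw [hL]
    push Not at hx
    obtain ⟨i, hi⟩ := hx
    have h1 : f (τ i) =ᶠ[𝓝 (x i)] 0 := notMem_tsupport_iff_eventuallyEq.1 fun h => hi (H.supp _ h)
    by_cases hij : i = j
    · subst hij
      rw [h1.fderiv_eq]
      simp
    · rw [Finset.prod_eq_zero (Finset.mem_erase.2 ⟨hij, Finset.mem_univ i⟩), mul_zero]
      rw [h1.eq_of_nhds]; simp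

theorem int_cube_prod {N : ℕ} (h : Fin N → Plane → ℝ) :
    ∫ x in cube N Q0, ∏ i, h i (x i) = ∏ i, ∫ z in Q0, h i z := by
  unfold cube
  rw [volume_pi, Measure.restrict_pi_pi]
  exact integral_fintype_prod_eq_prod _

theorem Q0_bdd : Bornology.IsBounded Q0 :=
  (Metric.isBounded_Ioo 0 1).prod (Metric.isBounded_Ioo 0 1)

theorem Cells.energy {N : ℕ} {f : Fin N → Plane → ℝ} {B : Fin N → Set Plane} (H : Cells N f B)
    (α L : ℝ) (hL : ∀ i, ∫ z in Q0, ((fderiv ℝ (f i) z (1, 0)) ^ 2 + (fderiv ℝ (f i) z (0, 1)) ^ 2)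
      ≤ L * ∫ z in Q0, (f i z) ^ 2) :
    normSq N Q0 (trial α f) = (N.factorial : ℝ) * ∏ i, ∫ z in Q0, (f i z) ^ 2 ∧
    kinE N α Q0 (trial α f) ≤ (N : ℝ) * L * normSq N Q0 (trial α f) := by
  have hfc : ∀ i, Continuous (f i) := fun i => (H.smooth i).continuous
  have hdc : ∀ i v, Continuous fun z => fderiv ℝ (f i) z v := fun i v =>
    ((H.smooth i).continuous_fderiv (by simp)).clm_apply continuous_const
  have hn : normSq N Q0 (trial α f) = (N.factorial : ℝ) * ∏ i, ∫ z in Q0, (f i z) ^ 2 := by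
    unfold normSq
    simp only [H.norm_trial]
    rw [integral_finsetSum]
    · have : ∀ τ : Equiv.Perm (Fin N), ∫ x in cube N Q0, ∏ i, (f (τ i) (x i)) ^ 2
          = ∏ i, ∫ z in Q0, (f i z) ^ 2 := by
        intro τ
        rw [int_cube_prod fun i z => (f (τ i) z) ^ 2]
        exact Equiv.prod_comp τ fun i => ∫ z in Q0, (f i z) ^ 2
      simp only [this]
      simp [Fintype.card_perm]
    · intro τ _
      refine int_pi _ (fun _ => Q0_bdd) _ ?_
      exact continuous_finset_prod _ fun i _ => ((hfc _).comp (continuous_apply i)).pow 2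
  refine ⟨hn, ?_⟩
  rw [hn]
  unfold kinE
  simp only [H.DSq_trial]
  have hj : ∀ j : Fin N, ∫ x in cube N Q0, ∑ τ : Equiv.Perm (Fin N), ((fderiv ℝ (f (τ j)) (x j) (1, 0)) ^ 2 +
      (fderiv ℝ (f (τ j)) (x j) (0, 1)) ^ 2) * ∏ i ∈ Finset.univ.erase j, (f (τ i) (x i)) ^ 2
      ≤ L * ((N.factorial : ℝ) * ∏ i, ∫ z in Q0, (f i z) ^ 2) := by
    intro j
    rw [integral_finsetSum]
    · have : ∀ τ : Equiv.Perm (Fin N), ∫ x in cube N Q0, ((fderiv ℝ (f (τ j)) (x j) (1, 0)) ^ 2 +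
          (fderiv ℝ (f (τ j)) (x j) (0, 1)) ^ 2) * ∏ i ∈ Finset.univ.erase j, (f (τ i) (x i)) ^ 2
          ≤ L * ∏ i, ∫ z in Q0, (f i z) ^ 2 := by
        intro τ
        have e : ∀ x : Config N, ((fderiv ℝ (f (τ j)) (x j) (1, 0)) ^ 2 +
          (fderiv ℝ (f (τ j)) (x j) (0, 1)) ^ 2) * ∏ i ∈ Finset.univ.erase j, (f (τ i) (x i)) ^ 2
          = ∏ i, (if i = j then (fun z => (fderiv ℝ (f (τ j)) z (1, 0)) ^ 2 +
              (fderiv ℝ (f (τ j)) z (0, 1)) ^ 2) else fun z => (f (τ i) z) ^ 2) (x i) := by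
          intro x
          rw [← Finset.mul_prod_erase _ _ (Finset.mem_univ j)]
          simp only [if_true]
          congr 1
          refine Finset.prod_congr rfl fun i hi => ?_
          rw [if_neg (Finset.ne_of_mem_erase hi)]
        simp only [e]
        rw [int_cube_prod, ← Equiv.prod_comp τ fun i => ∫ z in Q0, (f i z) ^ 2,
          ← Finset.mul_prod_erase _ _ (Finset.mem_univ j),
          ← Finset.mul_prod_erase _ (fun i => ∫ z in Q0, (f (τ i) z) ^ 2) (Finset.mem_univ j), ← mul_assoc]
        have e2 : ∏ i ∈ Finset.univ.erase j, ∫ z in Q0, (if i = j then (fun z => (fderiv ℝ (f (τ j)) z (1, 0)) ^ 2 +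
              (fderiv ℝ (f (τ j)) z (0, 1)) ^ 2) else fun z => (f (τ i) z) ^ 2) z
            = ∏ i ∈ Finset.univ.erase j, ∫ z in Q0, (f (τ i) z) ^ 2 := by
          refine Finset.prod_congr rfl fun i hi => ?_
          rw [if_neg (Finset.ne_of_mem_erase hi)]
        rw [e2]
        refine mul_le_mul_of_nonneg_right ?_
          (Finset.prod_nonneg fun i _ => integral_nonneg fun z => by positivity)
        simp only [if_true]
        exact hL (τ j)
      refine (Finset.sum_le_sum fun τ _ => this τ).trans (le_of_eq ?_)
      simp [Fintype.card_perm]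
      ring
    · intro τ _
      refine int_pi _ (fun _ => Q0_bdd) _ ?_
      refine Continuous.mul ?_ ?_
      · exact (((hdc _ _).comp (continuous_apply j)).pow 2).add (((hdc _ _).comp (continuous_apply j)).pow 2)
      · exact continuous_finset_prod _ fun i _ => ((hfc _).comp (continuous_apply i)).pow 2
  refine (Finset.sum_le_sum fun j _ => hj j).trans (le_of_eq ?_)
  simp
  ring

theorem normalise {N : ℕ} (α : ℝ) (Ω : Set Plane) (Ψ : Config N → ℂ) (hΨ : Admissible N Ψ) (M : ℝ)
    (h0 : 0 < normSq N Ω Ψ) (hM : kinE N α Ω Ψ ≤ M * normSq N Ω Ψ) :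
    ∃ Ψ' : Config N → ℂ, Admissible N Ψ' ∧ normSq N Ω Ψ' = 1 ∧ kinE N α Ω Ψ' ≤ M := by
  set c : ℝ := (Real.sqrt (normSq N Ω Ψ))⁻¹ with hc
  have hc2 : c ^ 2 = (normSq N Ω Ψ)⁻¹ := by rw [hc, inv_pow, Real.sq_sqrt h0.le]
  refine ⟨fun x => (c : ℂ) * Ψ x, ⟨contDiff_const.mul hΨ.smooth, fun σ x => ?_, ?_⟩, ?_, ?_⟩
  · simp only [hΨ.symm σ x]
  · obtain ⟨U, h1, h2, h3⟩ := hΨ.vanishes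
    exact ⟨U, h1, h2, fun x hx => by simp [h3 x hx]⟩
  · have : ∀ x, ‖(c : ℂ) * Ψ x‖ ^ 2 = c ^ 2 * ‖Ψ x‖ ^ 2 := by
      intro x; rw [norm_mul, mul_pow]; simp
    unfold normSq
    simp only [this]
    rw [integral_const_mul, hc2]
    exact inv_mul_cancel₀ h0.ne'
  · have hp : ∀ j v x, pder N j v (fun x => (c : ℂ) * Ψ x) x = (c : ℂ) * pder N j v Ψ x := by
      intro j v x
      unfold pder
      rw [fderiv_const_mul (hΨ.smooth.differentiable (by simp) x)]
      simp
    have : ∀ j x, DSq N α j (fun x => (c : ℂ) * Ψ x) x = c ^ 2 * DSq N α j Ψ x := by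
      intro j x
      have aux : ∀ (p q A : ℂ), ‖-Complex.I * ((c : ℂ) * p) + A * ((c : ℂ) * q)‖ ^ 2
          = c ^ 2 * ‖-Complex.I * p + A * q‖ ^ 2 := by
        intro p q A
        have : -Complex.I * ((c : ℂ) * p) + A * ((c : ℂ) * q) = (c : ℂ) * (-Complex.I * p + A * q) := by ring
        rw [this, norm_mul, mul_pow]; simp
      unfold DSq DOp
      simp only [hp, aux]
      ring
    unfold kinE
    simp only [this, integral_const_mul]
    rw [← Finset.mul_sum, hc2, inv_mul_le_iff₀ h0]
    unfold kinE at hM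
    linarith

/-- A fixed bump on the line. -/
def gb : ContDiffBump (1 / 2 : ℝ) := ⟨1 / 8, 1 / 4, by norm_num, by norm_num⟩

theorem gb_smooth : ContDiff ℝ (⊤ : ℕ∞) gb := gb.contDiff

theorem gb_zero (t : ℝ) (h : t ∉ Metric.closedBall (1 / 2 : ℝ) (1 / 4)) : gb t = 0 := by
  have : t ∉ tsupport gb := by rw [gb.tsupport_eq]; exact h
  exact image_eq_zero_of_notMem_tsupport this

theorem gball_sub : Metric.closedBall (1 / 2 : ℝ) (1 / 4) ⊆ Ioo 0 1 := by
  intro t ht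
  rw [Real.closedBall_eq_Icc] at ht
  constructor <;> linarith [ht.1, ht.2]

theorem gb_dzero (t : ℝ) (h : t ∉ Metric.closedBall (1 / 2 : ℝ) (1 / 4)) : deriv gb t = 0 := by
  have : t ∉ tsupport gb := by rw [gb.tsupport_eq]; exact h
  rw [(notMem_tsupport_iff_eventuallyEq.1 this).deriv_eq]
  simp

theorem gb_int : 0 < ∫ t, (gb t) ^ 2 := by
  have hc : Continuous fun t => (gb t) ^ 2 := gb_smooth.continuous.pow 2
  have hs : HasCompactSupport fun t => (gb t) ^ 2 := by
    refine HasCompactSupport.of_support_subset_isCompact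
      (isCompact_closedBall (1 / 2 : ℝ) (1 / 4)) ?_
    intro t ht
    by_contra h
    exact ht (by simp [gb_zero t h])
  refine hc.integral_pos_of_hasCompactSupport_nonneg_nonzero hs (fun t => by positivity)
    (x := 1 / 2) ?_
  have : gb (1 / 2 : ℝ) = 1 := gb.one_of_mem_closedBall (by simp [gb])
  rw [this]; norm_num

/-- Bump in the cell with offsets `p, q` of size `1/m`. -/
def fcell (m p q : ℝ) (z : Plane) : ℝ := gb (m * z.1 - p) * gb (m * z.2 - q)

/-- Open cells. -/
def Bcell (m p q : ℝ) : Set Plane := {z | m * z.1 - p ∈ Ioo (0 : ℝ) 1 ∧ m * z.2 - q ∈ Ioo (0 : ℝ) 1}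

theorem fcell_smooth (m p q : ℝ) : ContDiff ℝ (⊤ : ℕ∞) (fcell m p q) := by
  unfold fcell
  refine ContDiff.mul (gb_smooth.comp ?_) (gb_smooth.comp ?_)
  · exact (contDiff_const.mul contDiff_fst).sub contDiff_const
  · exact (contDiff_const.mul contDiff_snd).sub contDiff_const

theorem fcell_supp (m p q : ℝ) : tsupport (fcell m p q) ⊆ Bcell m p q := by
  have hcl : IsClosed {z : Plane | m * z.1 - p ∈ Metric.closedBall (1 / 2 : ℝ) (1 / 4) ∧
      m * z.2 - q ∈ Metric.closedBall (1 / 2 : ℝ) (1 / 4)} := by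
    refine IsClosed.inter ?_ ?_
    · exact Metric.isClosed_closedBall.preimage (by fun_prop : Continuous fun z : Plane => m * z.1 - p)
    · exact Metric.isClosed_closedBall.preimage (by fun_prop : Continuous fun z : Plane => m * z.2 - q)
  refine (closure_minimal ?_ hcl).trans fun z hz => ⟨gball_sub hz.1, gball_sub hz.2⟩
  intro z hz
  by_contra h
  apply hz
  rw [mem_ofPred_eq, not_and_or] at h
  unfold fcell
  rcases h with h | h
  · rw [gb_zero _ h, zero_mul]
  · rw [gb_zero _ h, mul_zero]

theorem fcell_deriv (m p q : ℝ) (z : Plane) :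
    fderiv ℝ (fcell m p q) z (1, 0) = m * (deriv gb (m * z.1 - p) * gb (m * z.2 - q)) ∧
    fderiv ℝ (fcell m p q) z (0, 1) = m * (gb (m * z.1 - p) * deriv gb (m * z.2 - q)) := by
  have hd : ∀ t, HasDerivAt gb (deriv gb t) t := fun t =>
    (gb_smooth.differentiable (by simp) t).hasDerivAt
  have h1 : HasFDerivAt (fun z : Plane => m * z.1 - p) (m • ContinuousLinearMap.fst ℝ ℝ ℝ) z :=
    (hasFDerivAt_fst.const_mul m).sub_const p
  have h2 : HasFDerivAt (fun z : Plane => m * z.2 - q) (m • ContinuousLinearMap.snd ℝ ℝ ℝ) z :=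
    (hasFDerivAt_snd.const_mul m).sub_const q
  have h3 := ((hd _).comp_hasFDerivAt z h1).mul ((hd _).comp_hasFDerivAt z h2)
  have : fderiv ℝ (fcell m p q) z = _ := h3.fderiv
  rw [this]
  constructor
  · simp; ring
  · simp; ring

theorem int_affine (h : ℝ → ℝ) (m p : ℝ) (hm : 0 < m) : ∫ t, h (m * t - p) = m⁻¹ * ∫ t, h t := by
  rw [Measure.integral_comp_mul_left (fun t => h (t - p)) m, integral_sub_right_eq_self h p,
    abs_of_pos (by positivity), smul_eq_mul]

theorem int_cell (u v : ℝ → ℝ) (hu : ∀ t ∉ Metric.closedBall (1 / 2 : ℝ) (1 / 4), u t = 0)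
    (hv : ∀ t ∉ Metric.closedBall (1 / 2 : ℝ) (1 / 4), v t = 0) (m p q : ℝ) (hm : 0 < m)
    (hB : Bcell m p q ⊆ Q0) :
    ∫ z in Q0, (u (m * z.1 - p) * v (m * z.2 - q)) = m⁻¹ * (∫ t, u t) * (m⁻¹ * ∫ t, v t) := by
  rw [setIntegral_eq_integral_of_forall_compl_eq_zero]
  · rw [← int_affine u m p hm, ← int_affine v m q hm]
    exact integral_prod_mul (fun x => u (m * x - p)) (fun y => v (m * y - q))
  · intro z hz
    by_contra h
    apply hz
    apply hB
    constructor
    · by_contra h'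
      exact h (by rw [hu _ fun hh => h' (gball_sub hh), zero_mul])
    · by_contra h'
      exact h (by rw [hv _ fun hh => h' (gball_sub hh), mul_zero])

theorem fcell_int (m p q : ℝ) (hm : 0 < m) (hB : Bcell m p q ⊆ Q0) :
    0 < ∫ z in Q0, (fcell m p q z) ^ 2 ∧
    ∫ z in Q0, ((fderiv ℝ (fcell m p q) z (1, 0)) ^ 2 + (fderiv ℝ (fcell m p q) z (0, 1)) ^ 2)
      ≤ (2 * (∫ t, (deriv gb t) ^ 2) / (∫ t, (gb t) ^ 2)) * m ^ 2 * ∫ z in Q0, (fcell m p q z) ^ 2 := by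
  have hI := gb_int
  have hz2 : ∀ t ∉ Metric.closedBall (1 / 2 : ℝ) (1 / 4), (gb t) ^ 2 = 0 := fun t ht => by
    rw [gb_zero t ht]; norm_num
  have hd2 : ∀ t ∉ Metric.closedBall (1 / 2 : ℝ) (1 / 4), (deriv gb t) ^ 2 = 0 := fun t ht => by
    rw [gb_dzero t ht]; norm_num
  have e0 : ∫ z in Q0, (fcell m p q z) ^ 2 = m⁻¹ * (∫ t, (gb t) ^ 2) * (m⁻¹ * ∫ t, (gb t) ^ 2) := by
    rw [← int_cell _ _ hz2 hz2 m p q hm hB]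
    simp only [fcell, mul_pow]
  have hgc := gb_smooth.continuous
  have hdc : Continuous (deriv gb) := gb_smooth.continuous_deriv (by simp)
  have hi : ∀ u : Plane → ℝ, Continuous u → IntegrableOn u Q0 := fun u hu => integrableOn_bdd volume u hu Q0 Q0_bdd
  have e1 : ∫ z in Q0, ((fderiv ℝ (fcell m p q) z (1, 0)) ^ 2 + (fderiv ℝ (fcell m p q) z (0, 1)) ^ 2)
      = m ^ 2 * (m⁻¹ * (∫ t, (deriv gb t) ^ 2) * (m⁻¹ * ∫ t, (gb t) ^ 2))
        + m ^ 2 * (m⁻¹ * (∫ t, (gb t) ^ 2) * (m⁻¹ * ∫ t, (deriv gb t) ^ 2)) := by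
    rw [← int_cell _ _ hz2 hd2 m p q hm hB, ← int_cell _ _ hd2 hz2 m p q hm hB,
      ← integral_const_mul, ← integral_const_mul, ← integral_add]
    · refine integral_congr_ae (Filter.Eventually.of_forall fun z => ?_)
      simp only [(fcell_deriv m p q z).1, (fcell_deriv m p q z).2]
      ring
    · exact hi _ (by fun_prop)
    · exact hi _ (by fun_prop)
  rw [e0, e1]
  constructor
  · positivity
  · refine le_of_eq ?_
    field_simp
    ring

theorem Bcell_Q0 (m p q : ℕ) (hm : 0 < m) (hp : p < m) (hq : q < m) :
    Bcell m p q ⊆ Q0 := by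
  have hm0 : (0 : ℝ) < m := by exact_mod_cast hm
  have aux : ∀ (p : ℕ) (t : ℝ), p < m → (m : ℝ) * t - p ∈ Ioo (0 : ℝ) 1 → t ∈ Ioo (0 : ℝ) 1 := by
    intro p t hp ht
    have h1 : (p : ℝ) + 1 ≤ m := by exact_mod_cast hp
    have h2 : (0 : ℝ) ≤ p := by positivity
    constructor
    · by_contra! h; nlinarith [ht.1]
    · by_contra! h; nlinarith [ht.2]
  exact fun z hz => ⟨aux p _ hp hz.1, aux q _ hq hz.2⟩

theorem cells_exist (N m : ℕ) (hm : 0 < m) :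
    Cells N (fun i => fcell m ((i : ℕ) % m : ℕ) ((i : ℕ) / m : ℕ))
      (fun i => Bcell m ((i : ℕ) % m : ℕ) ((i : ℕ) / m : ℕ)) where
  smooth := fun i => fcell_smooth _ _ _
  supp := fun i => fcell_supp _ _ _
  slit := by
    intro i k hik x hx y hy
    have hm0 : (0 : ℝ) < m := by exact_mod_cast hm
    rw [toC_apply, Complex.mem_slitPlane_iff]
    simp only [Prod.fst_sub, Prod.snd_sub]
    have hik' : (i : ℕ) < k := hik
    have hq : (i : ℕ) / m ≤ (k : ℕ) / m := Nat.div_le_div_right hik'.le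
    rcases hq.lt_or_eq with h | h
    · right
      have h1 : (((i : ℕ) / m : ℕ) : ℝ) + 1 ≤ ((k : ℕ) / m : ℕ) := by exact_mod_cast h
      have h2 := hx.2.2
      have h3 := hy.2.1
      have : 0 < (m : ℝ) * (y.2 - x.2) := by linarith
      exact (pos_of_mul_pos_right this hm0.le).ne'
    · left
      have e1 := Nat.div_add_mod (i : ℕ) m
      have e2 := Nat.div_add_mod (k : ℕ) m
      rw [← h] at e2
      have h0 : (i : ℕ) % m + 1 ≤ (k : ℕ) % m := by omega
      have h1 : (((i : ℕ) % m : ℕ) : ℝ) + 1 ≤ ((k : ℕ) % m : ℕ) := by exact_mod_cast h0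
      have h2 := hx.1.2
      have h3 := hy.1.1
      have : 0 < (m : ℝ) * (y.1 - x.1) := by linarith
      exact pos_of_mul_pos_right this hm0.le

theorem trial_exists (α : ℝ) : ∃ L : ℝ, ∀ N m : ℕ, 0 < m → N ≤ m * m →
    ∃ Ψ : Config N → ℂ, Admissible N Ψ ∧ normSq N Q0 Ψ = 1 ∧ kinE N α Q0 Ψ ≤ L * N * (m : ℝ) ^ 2 := by
  refine ⟨2 * (∫ t, (deriv gb t) ^ 2) / (∫ t, (gb t) ^ 2), ?_⟩
  intro N m hm hN
  have hm0 : (0 : ℝ) < m := by exact_mod_cast hm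
  have H := cells_exist N m hm
  have hB : ∀ i : Fin N, Bcell m ((i : ℕ) % m : ℕ) ((i : ℕ) / m : ℕ) ⊆ Q0 := fun i =>
    Bcell_Q0 m _ _ hm (Nat.mod_lt _ hm) ((Nat.div_lt_iff_lt_mul hm).2 (lt_of_lt_of_le i.2 hN))
  have hE := H.energy α ((2 * (∫ t, (deriv gb t) ^ 2) / (∫ t, (gb t) ^ 2)) * (m : ℝ) ^ 2)
    (fun i => (fcell_int m _ _ hm0 (hB i)).2)
  refine normalise α Q0 _ (H.admissible α) _ ?_ (hE.2.trans (le_of_eq ?_))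
  · rw [hE.1]
    exact mul_pos (by exact_mod_cast N.factorial_pos)
      (Finset.prod_pos fun i _ => (fcell_int m _ _ hm0 (hB i)).1)
  · ring

theorem EN_nonempty (N : ℕ) (α : ℝ) (hN : N ≠ 0) :
    {E | ∃ Ψ : Config N → ℂ, Admissible N Ψ ∧ normSq N Q0 Ψ = 1 ∧ E = kinE N α Q0 Ψ}.Nonempty := by
  obtain ⟨L, hL⟩ := trial_exists α
  obtain ⟨Ψ, h1, h2, h3⟩ := hL N N (Nat.pos_of_ne_zero hN) (Nat.le_mul_self N)
  exact ⟨_, Ψ, h1, h2, rfl⟩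

theorem kinE_nonneg (N : ℕ) (α : ℝ) (Ω : Set Plane) (Ψ : Config N → ℂ) : 0 ≤ kinE N α Ω Ψ :=
  Finset.sum_nonneg fun _ _ => integral_nonneg fun _ => DSq_nonneg _ _ _ _ _

theorem EN_le (N : ℕ) (α : ℝ) (hN : N ≠ 0) (Ψ : Config N → ℂ) (h1 : Admissible N Ψ)
    (h2 : normSq N Q0 Ψ = 1) : EN N α ≤ kinE N α Q0 Ψ := by
  unfold EN neumannE
  rw [if_neg hN]
  refine csInf_le ⟨0, ?_⟩ ⟨Ψ, h1, h2, rfl⟩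
  rintro E ⟨Φ, -, -, rfl⟩
  exact kinE_nonneg _ _ _ _

theorem EN_lower (N : ℕ) (α : ℝ) (hα : 0 < α) (hα1 : α ≤ 1 / 10 ^ 10) (hN : 2 ≤ N) :
    π * α * ((N : ℝ) ^ 2 / 4 - 8 * N) ≤ EN N α := by
  unfold EN neumannE
  rw [if_neg (by omega)]
  refine le_csInf (EN_nonempty N α (by omega)) ?_
  rintro E ⟨Ψ, h1, h2, rfl⟩
  set K := Nat.sqrt (N / 2) with hKd
  have hK : 0 < K := Nat.sqrt_pos.2 (by omega)
  have h3 := kinE_lower N Ψ h1 α hα hα1 K hK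
  rw [h2, mul_one] at h3
  refine le_trans ?_ h3
  have k1 : K * K ≤ N / 2 := Nat.sqrt_le _
  have k2 : N / 2 < (K + 1) * (K + 1) := Nat.lt_succ_sqrt _
  have k3 : 2 * (K * K) ≤ N := by omega
  have k4 : N ≤ 2 * (K * K) + 4 * K + 1 := by
    have : N ≤ 2 * (N / 2) + 1 := by omega
    nlinarith
  have r3 : 2 * ((K : ℝ) * K) ≤ N := by exact_mod_cast k3
  have r4 : (N : ℝ) ≤ 2 * ((K : ℝ) * K) + 4 * K + 1 := by exact_mod_cast k4
  have r5 : (1 : ℝ) ≤ K := by exact_mod_cast hK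
  have r6 : (2 : ℝ) ≤ N := by exact_mod_cast hN
  have key : (N : ℝ) ^ 2 / 4 - 8 * N ≤ (K : ℝ) ^ 2 * (N - (K : ℝ) ^ 2) := by
    have hd : ((N : ℝ) - 2 * ((K : ℝ) * K)) ^ 2 ≤ (4 * (K : ℝ) + 1) ^ 2 :=
      pow_le_pow_left₀ (by linarith) (by linarith) 2
    nlinarith
  have hpa : 0 < π * α := by positivity
  nlinarith [mul_le_mul_of_nonneg_left key hpa.le]

/-- There exist constants `C > 0` and `α₀ ∈ (0,1]` such that for every
`α ∈ (0, α₀]`, `liminf_{N→∞} E^N_N(α)/N² ≥ (π/4) α (1 − C α^{1/3})`. -/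
theorem neumann_liminf_lower_bound :
    ∃ C α₀ : ℝ, 0 < C ∧ α₀ ∈ Set.Ioc (0 : ℝ) 1 ∧ ∀ α ∈ Set.Ioc (0 : ℝ) α₀,
      (π / 4) * α * (1 - C * α ^ ((1 : ℝ) / 3)) ≤
        Filter.atTop.liminf (fun N : ℕ => EN N α / (N : ℝ) ^ 2) := by
  refine ⟨1, 1 / 10 ^ 10, one_pos, ⟨by norm_num, by norm_num⟩, ?_⟩
  rintro α ⟨hα, hα1⟩
  set ε := α ^ ((1 : ℝ) / 3) with hε
  have hε0 : 0 < ε := Real.rpow_pos_of_pos hα _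
  refine Filter.le_liminf_of_le ?_ ?_
  · obtain ⟨L, hL⟩ := trial_exists α
    refine Filter.IsCoboundedUnder.of_frequently_le (a := L) ?_
    rw [Filter.frequently_atTop]
    intro n
    refine ⟨(n + 1) * (n + 1), by nlinarith, ?_⟩
    have hN : (n + 1) * (n + 1) ≠ 0 := by positivity
    obtain ⟨Ψ, h1, h2, h3⟩ := hL ((n + 1) * (n + 1)) (n + 1) (by omega) le_rfl
    have h4 := (EN_le _ α hN Ψ h1 h2).trans h3
    have hp : (0 : ℝ) < ((((n + 1) * (n + 1) : ℕ)) : ℝ) ^ 2 := by positivity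
    rw [div_le_iff₀ hp]
    refine h4.trans (le_of_eq ?_)
    push_cast
    ring
  · obtain ⟨M, hM⟩ := exists_nat_gt (32 / ε)
    filter_upwards [Filter.eventually_ge_atTop (M + 2)] with N hN
    have hN2 : 2 ≤ N := by omega
    have h1 := EN_lower N α hα hα1 hN2
    have hN0 : (0 : ℝ) < N := by exact_mod_cast (by omega : 0 < N)
    rw [le_div_iff₀ (by positivity)]
    refine le_trans ?_ h1
    have hMN : (M : ℝ) ≤ N := by exact_mod_cast (by omega : M ≤ N)
    have h2 : 32 < ε * N := by
      rw [div_lt_iff₀ hε0] at hM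
      nlinarith
    have hpa : 0 < π * α := by positivity
    have h3 : (1 - 1 * ε) * (N : ℝ) ^ 2 / 4 ≤ (N : ℝ) ^ 2 / 4 - 8 * N := by nlinarith
    calc π / 4 * α * (1 - 1 * ε) * (N : ℝ) ^ 2 = π * α * ((1 - 1 * ε) * (N : ℝ) ^ 2 / 4) := by ring
      _ ≤ _ := mul_le_mul_of_nonneg_left h3 hpa.le
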